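/- Let β>0, let h be a real analytic and even Schwartz function, and let Q be real analytic, strongly convex and even with α_Q > α^h (where α^h is as in the global convergence theorem). Then for every k = 1, 2, …, the k-th correlation measure ρ_{N,Q,β}^{h,k}(t_1,…,t_k)dt_1…dt_k of P_{N,Q,β}^h converges weakly, as N→∞, to the k-fold product measure (μ_{Q,β}^h)^{⊗k}, where μ_{Q,β}^h is the weak limit of the first correlation measure. -/

import Mathlib

open MeasureTheory Real Filter Finset Topology

noncomputable section

/-- Product over pairs `i < j` of `|x i - x j| ^ β` (the β-Vandermonde interaction). -/
def vdm (β : ℝ) {N : ℕ} (x : Fin N → ℝ) : ℝ :=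
  ∏ p ∈ Finset.univ.filter (fun p : Fin N × Fin N => p.1 < p.2), |x p.1 - x p.2| ^ β

/-- Sum over pairs `i < j` of `g (x i - x j)`. -/
def pairSum {N : ℕ} (g : ℝ → ℝ) (x : Fin N → ℝ) : ℝ :=
  ∑ p ∈ Finset.univ.filter (fun p : Fin N × Fin N => p.1 < p.2), g (x p.1 - x p.2)

/-- Unnormalized density of `P_{N,Q,β}^h`. -/
def weightH (β : ℝ) (Q g : ℝ → ℝ) (N : ℕ) (x : Fin N → ℝ) : ℝ :=
  vdm β x * Real.exp (-(N : ℝ) * ∑ j, Q (x j) - pairSum g x)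

/-- Normalization constant `Z_{N,Q,β}^h`. -/
def ZH (β : ℝ) (Q g : ℝ → ℝ) (N : ℕ) : ℝ := ∫ x : Fin N → ℝ, weightH β Q g N x

/-- The density `P_{N,Q,β}^h`. -/
def PH (β : ℝ) (Q g : ℝ → ℝ) (N : ℕ) (x : Fin N → ℝ) : ℝ := weightH β Q g N x / ZH β Q g N

/-- Unnormalized density of the β-ensemble `P_{N,V,β}`. -/
def weightV (β : ℝ) (V : ℝ → ℝ) (N : ℕ) (x : Fin N → ℝ) : ℝ :=
  vdm β x * Real.exp (-(N : ℝ) * ∑ j, V (x j))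

/-- Normalization constant `Z_{N,V,β}`. -/
def ZV (β : ℝ) (V : ℝ → ℝ) (N : ℕ) : ℝ := ∫ x : Fin N → ℝ, weightV β V N x

/-- The β-ensemble density `P_{N,V,β}`. -/
def PV (β : ℝ) (V : ℝ → ℝ) (N : ℕ) (x : Fin N → ℝ) : ℝ := weightV β V N x / ZV β V N

/-- Expectation w.r.t. `P_{N,Q,β}^h`. -/
def EH (β : ℝ) (Q g : ℝ → ℝ) (N : ℕ) (f : (Fin N → ℝ) → ℝ) : ℝ :=
  ∫ x : Fin N → ℝ, f x * PH β Q g N x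

/-- Expectation w.r.t. `P_{N,V,β}`. -/
def EV (β : ℝ) (V : ℝ → ℝ) (N : ℕ) (f : (Fin N → ℝ) → ℝ) : ℝ :=
  ∫ x : Fin N → ℝ, f x * PV β V N x

/-- `k`-th correlation function of a density `P` on `ℝ^N`. -/
def correlationFn (N k : ℕ) (P : (Fin N → ℝ) → ℝ) (t : Fin k → ℝ) : ℝ :=
  ∫ y : Fin (N - k) → ℝ,
    P (fun i => if hik : (i : ℕ) < k then t ⟨(i : ℕ), hik⟩
        else y ⟨(i : ℕ) - k, by have := i.isLt; omega⟩)

/-- `f_μ(s) = ∫ f(t-s) dμ(t)`. -/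
def fMu (g : ℝ → ℝ) (μ : Measure ℝ) (s : ℝ) : ℝ := ∫ t, g (t - s) ∂μ

/-- `f_{μμ} = ∬ f(t-s) dμ(t) dμ(s)`. -/
def fMuMu (g : ℝ → ℝ) (μ : Measure ℝ) : ℝ := ∫ s, fMu g μ s ∂μ

/-- The Hoeffding-remainder `U(x)`. -/
def UU (g : ℝ → ℝ) (μ : Measure ℝ) (N : ℕ) (x : Fin N → ℝ) : ℝ :=
  -(1/2) * ∑ i, ∑ j, (g (x i - x j) - fMu g μ (x i) - fMu g μ (x j) + fMuMu g μ)

/-- The weighted logarithmic energy functional `I_{V,β}`. -/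
def logEnergy (β : ℝ) (V : ℝ → ℝ) (μ : Measure ℝ) : ℝ :=
  ∫ t, V t ∂μ + β / 2 * ∫ s, ∫ t, Real.log |s - t|⁻¹ ∂μ ∂μ

/-- `μ` is the equilibrium measure to the external field `V` and `β`. -/
def IsEquilibriumMeasure (β : ℝ) (V : ℝ → ℝ) (μ : Measure ℝ) : Prop :=
  IsProbabilityMeasure μ ∧
    ∀ ν : Measure ℝ, IsProbabilityMeasure ν → logEnergy β V μ ≤ logEnergy β V ν

/-- `α_Q = inf_t Q''(t)`. -/
def alphaQ (Q : ℝ → ℝ) : ℝ := ⨅ t : ℝ, iteratedDeriv 2 Q t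

/-- `g` is (the restriction of) a Schwartz function. -/
def IsSchwartz (g : ℝ → ℝ) : Prop := ∃ H : SchwartzMap ℝ ℝ, ∀ t, H t = g t

/-- `g` is an even function. -/
def IsEvenFun (g : ℝ → ℝ) : Prop := ∀ t, g (-t) = g t

/-- Partial derivative in coordinate `j`. -/
def partialDeriv {N : ℕ} (f : (Fin N → ℝ) → ℝ) (j : Fin N) (x : Fin N → ℝ) : ℝ :=
  deriv (fun s => f (Function.update x j s)) (x j)

/-- Dirichlet form `D_ω(f) = (2N)⁻¹ ∑_j ∫ (∂_j f)² dω`. -/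
def dirichletForm {N : ℕ} (ω : Measure (Fin N → ℝ)) (f : (Fin N → ℝ) → ℝ) : ℝ :=
  (1 / (2 * (N : ℝ))) * ∑ j : Fin N, ∫ x, (partialDeriv f j x) ^ 2 ∂ω

/-- Relative entropy `S_ω(q) = ∫ q log q dω`. -/
def entropy {N : ℕ} (ω : Measure (Fin N → ℝ)) (q : (Fin N → ℝ) → ℝ) : ℝ :=
  ∫ x, q x * Real.log (q x) ∂ω

/-- The measure with density `P_{N,V,β}`. -/
def measV (β : ℝ) (V : ℝ → ℝ) (N : ℕ) : Measure (Fin N → ℝ) :=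
  volume.withDensity (fun x => ENNReal.ofReal (PV β V N x))

/-- `Z_{N,V,β,U}`. -/
def ZVU (β : ℝ) (V g : ℝ → ℝ) (μ : Measure ℝ) (N : ℕ) : ℝ :=
  ∫ x : Fin N → ℝ, vdm β x * Real.exp (-(N : ℝ) * ∑ j, V (x j) + UU g μ N x)

/-- probability of a set under `P_{N,V,β}`. -/
def ProbV (β : ℝ) (V : ℝ → ℝ) (N : ℕ) (A : Set (Fin N → ℝ)) : ℝ := ∫ x in A, PV β V N x

/-- probability of a set under `P_{N,Q,β}^h`. -/
def ProbH (β : ℝ) (Q g : ℝ → ℝ) (N : ℕ) (A : Set (Fin N → ℝ)) : ℝ := ∫ x in A, PH β Q g N x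

structure Hyp (β : ℝ) (Q h : ℝ → ℝ) (α K H : ℝ) : Prop where
  hβ : 0 < β
  hK : 0 ≤ K
  hαK : K < α
  Qev : ∀ t, Q (-t) = Q t
  hev : ∀ t, h (-t) = h t
  Qmid : ∀ a b, Q ((a + b) / 2) ≤ (Q a + Q b) / 2 - α / 8 * (a - b) ^ 2
  hmid : ∀ a b, h ((a + b) / 2) ≤ (h a + h b) / 2 + K / 8 * (a - b) ^ 2
  hH : ∀ t, |h t| ≤ H
  Qdiff : Differentiable ℝ Q
  hdiff : Differentiable ℝ h
  hd : ∀ a b, |deriv h a - deriv h b| ≤ K * |a - b|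
  hL : ∀ a b, |h a - h b| ≤ H * |a - b|
  Qd : ∀ R, ∃ L, 0 ≤ L ∧ ∀ a b, |a| ≤ R → |b| ≤ R →
    |deriv Q a - deriv Q b| ≤ L * |a - b| ∧ |Q a - Q b| ≤ L * |a - b|

lemma mid_of_deriv2 (f : ℝ → ℝ) (hf : ∀ x : ℝ, AnalyticAt ℝ f x) (α : ℝ)
    (h2 : ∀ t, α ≤ iteratedDeriv 2 f t) (a b : ℝ) :
    f ((a + b) / 2) ≤ (f a + f b) / 2 - α / 8 * (a - b) ^ 2 := by
  have hd : Differentiable ℝ f := fun x => (hf x).differentiableAt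
  have hd1 : Differentiable ℝ (deriv f) := fun x => (hf x).deriv.differentiableAt
  have hder : deriv (fun t => f t - α / 2 * t ^ 2) = fun t => deriv f t - α * t := by
    funext t
    have := ((hd t).hasDerivAt.sub (((hasDerivAt_id t).pow 2).const_mul (α / 2))).deriv
    simp at this
    refine Eq.trans this ?_
    ring
  have hder2 : ∀ t, deriv^[2] (fun t => f t - α / 2 * t ^ 2) t = iteratedDeriv 2 f t - α := by
    intro t
    simp only [Function.iterate_succ, Function.iterate_zero, Function.comp, id]
    rw [hder, iteratedDeriv_succ, iteratedDeriv_one]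
    have := ((hd1 t).hasDerivAt.sub ((hasDerivAt_id t).const_mul α)).deriv
    simp at this
    exact this
  have hc : ConvexOn ℝ Set.univ (fun t => f t - α / 2 * t ^ 2) := by
    apply convexOn_univ_of_deriv2_nonneg
    · fun_prop
    · rw [hder]; fun_prop
    · intro t; rw [hder2]; linarith [h2 t]
  have := hc.2 (Set.mem_univ a) (Set.mem_univ b) (by norm_num : (0:ℝ) ≤ 1/2)
    (by norm_num : (0:ℝ) ≤ 1/2) (by norm_num)
  simp only [smul_eq_mul] at this
  have e : (1/2 : ℝ) * a + 1/2 * b = (a + b) / 2 := by ring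
  rw [e] at this
  nlinarith

lemma lip_of_deriv_bound (f : ℝ → ℝ) (hf : Differentiable ℝ f) (C R : ℝ)
    (hC : ∀ t, |t| ≤ R → |deriv f t| ≤ C) (a b : ℝ) (ha : |a| ≤ R) (hb : |b| ≤ R) :
    |f a - f b| ≤ C * |a - b| := by
  have := Convex.norm_image_sub_le_of_norm_deriv_le (𝕜 := ℝ) (f := f) (s := Set.Icc (-R) R)
    (C := C) (x := b) (y := a) (fun x _ => hf x)
    (fun x hx => by rw [Real.norm_eq_abs]; exact hC x (abs_le.2 hx)) (convex_Icc _ _)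
    (abs_le.1 hb) (abs_le.1 ha)
  simpa [Real.norm_eq_abs] using this

lemma exists_K (h : ℝ → ℝ) (hAn : ∀ x : ℝ, AnalyticAt ℝ h x) (hSch : IsSchwartz h) :
    ∃ K H : ℝ, 0 ≤ K ∧ (∀ t, |iteratedDeriv 2 h t| ≤ K) ∧ (∀ t, |h t| ≤ H) ∧
      (∀ t, |deriv h t| ≤ H) := by
  obtain ⟨S, hS⟩ := hSch
  obtain rfl : (S : ℝ → ℝ) = h := funext hS
  obtain ⟨C0, h0⟩ := S.decay 0 0
  obtain ⟨C1, h1⟩ := S.decay 0 1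
  obtain ⟨C2, h2⟩ := S.decay 0 2
  simp only [norm_iteratedFDeriv_eq_norm_iteratedDeriv, pow_zero, one_mul] at h0 h1 h2
  refine ⟨C2, max C0 C1, ?_, ?_, ?_, ?_⟩
  · exact (norm_nonneg _).trans (h2.2 0)
  · exact fun t => h2.2 t
  · exact fun t => le_max_of_le_left (by simpa using h0.2 t)
  · exact fun t => le_max_of_le_right (by simpa using h1.2 t)

lemma mkHyp (β : ℝ) (hβ : 0 < β) (h : ℝ → ℝ) (hAn : ∀ x : ℝ, AnalyticAt ℝ h x)
    (hEv : IsEvenFun h) (K H : ℝ) (hK : 0 ≤ K) (hK2 : ∀ t, |iteratedDeriv 2 h t| ≤ K)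
    (hH : ∀ t, |h t| ≤ H) (hH1 : ∀ t, |deriv h t| ≤ H) (Q : ℝ → ℝ)
    (hQ : ∀ x : ℝ, AnalyticAt ℝ Q x) (hc : ∃ c > 0, ∀ t : ℝ, c ≤ iteratedDeriv 2 Q t)
    (hQe : IsEvenFun Q) (hα : K < alphaQ Q) : Hyp β Q h (alphaQ Q) K H := by
  have hd : Differentiable ℝ h := fun x => (hAn x).differentiableAt
  have hd1 : Differentiable ℝ (deriv h) := fun x => (hAn x).deriv.differentiableAt
  have qd : Differentiable ℝ Q := fun x => (hQ x).differentiableAt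
  have qd1 : Differentiable ℝ (deriv Q) := fun x => (hQ x).deriv.differentiableAt
  have qd2 : Differentiable ℝ (deriv (deriv Q)) := fun x => (hQ x).deriv.deriv.differentiableAt
  refine ⟨hβ, hK, hα, hQe, hEv, ?_, ?_, hH, qd, hd, ?_, ?_, ?_⟩
  · apply mid_of_deriv2 Q hQ
    intro t
    obtain ⟨c, -, hc⟩ := hc
    exact ciInf_le ⟨c, by rintro _ ⟨t, rfl⟩; exact hc t⟩ t
  · intro a b
    have := mid_of_deriv2 h hAn (-K) (fun t => (abs_le.1 (hK2 t)).1) a b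
    linarith
  · intro a b
    refine lip_of_deriv_bound (deriv h) hd1 K (max |a| |b|) ?_ a b (le_max_left _ _)
      (le_max_right _ _)
    intro t _
    have := hK2 t
    rwa [iteratedDeriv_succ, iteratedDeriv_one] at this
  · intro a b
    exact lip_of_deriv_bound h hd H (max |a| |b|) (fun t _ => hH1 t) a b (le_max_left _ _)
      (le_max_right _ _)
  · intro R
    obtain ⟨C1, hC1⟩ := (isCompact_Icc (a := -R) (b := R)).exists_bound_of_continuousOn
      qd1.continuous.continuousOn
    obtain ⟨C2, hC2⟩ := (isCompact_Icc (a := -R) (b := R)).exists_bound_of_continuousOn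
      qd2.continuous.continuousOn
    refine ⟨max 0 (max C1 C2), le_max_left _ _, fun a b ha hb => ⟨?_, ?_⟩⟩
    · exact lip_of_deriv_bound _ qd1 _ R (fun t ht => (hC2 t (abs_le.1 ht)).trans
        ((le_max_right _ _).trans (le_max_right _ _))) a b ha hb
    · exact lip_of_deriv_bound _ qd _ R (fun t ht => (hC1 t (abs_le.1 ht)).trans
        ((le_max_left _ _).trans (le_max_right _ _))) a b ha hb

def WW (β : ℝ) (h : ℝ → ℝ) (t : ℝ) : ℝ := h t - β * Real.log t

def En (β : ℝ) (Q h : ℝ → ℝ) {ι : Type} [Fintype ι] (x : ι → ℝ) : ℝ :=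
  (Fintype.card ι : ℝ) * ∑ i, Q (x i) + 1 / 2 * ∑ i, ∑ j, WW β h (x i - x j)

lemma En_comp (β : ℝ) (Q h : ℝ → ℝ) {ι κ : Type} [Fintype ι] [Fintype κ] (e : κ ≃ ι)
    (x : ι → ℝ) : En β Q h (fun k => x (e k)) = En β Q h x := by
  unfold En
  rw [Fintype.card_congr e, Equiv.sum_comp e (fun i => Q (x i))]
  congr 2
  rw [← Equiv.sum_comp e (fun i => ∑ j, WW β h (x i - x j))]
  refine Finset.sum_congr rfl fun i _ => ?_
  rw [Equiv.sum_comp e (fun j => WW β h (x (e i) - x j))]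

lemma log_mid (a b : ℝ) (hab : 0 < a * b) :
    (Real.log a + Real.log b) / 2 ≤ Real.log ((a + b) / 2) := by
  have ha : a ≠ 0 := by rintro rfl; simp at hab
  have hb : b ≠ 0 := by rintro rfl; simp at hab
  rw [← Real.log_mul ha hb]
  have h1 : Real.log (a * b) ≤ Real.log (((a + b) / 2) ^ 2) := by
    apply Real.log_le_log hab
    nlinarith [sq_nonneg (a - b)]
  rw [Real.log_pow] at h1
  push_cast at h1
  linarith

lemma pair_sq {ι : Type} [Fintype ι] (d : ι → ℝ) :
    ∑ i, ∑ j, (d i - d j) ^ 2 ≤ 2 * (Fintype.card ι : ℝ) * ∑ i, d i ^ 2 := by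
  have : ∑ i, ∑ j, (d i - d j) ^ 2
      = 2 * (Fintype.card ι : ℝ) * ∑ i, d i ^ 2 - 2 * (∑ i, d i) ^ 2 := by
    have : ∀ i j, (d i - d j) ^ 2 = d i ^ 2 + d j ^ 2 - 2 * (d i * d j) := by intros; ring
    simp_rw [this, Finset.sum_sub_distrib, Finset.sum_add_distrib, ← Finset.mul_sum,
      Finset.sum_const, Finset.card_univ, nsmul_eq_mul]
    rw [sq (∑ i, d i), Finset.sum_mul, ← Finset.mul_sum]
    ring
  rw [this]
  nlinarith [sq_nonneg (∑ i, d i)]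

lemma En_mid {β : ℝ} {Q h : ℝ → ℝ} {α K H : ℝ} (P : Hyp β Q h α K H)
    {ι : Type} [Fintype ι] (x y : ι → ℝ)
    (hxy : ∀ i j, i ≠ j → 0 < (x i - x j) * (y i - y j)) :
    En β Q h (fun i => (x i + y i) / 2) ≤ (En β Q h x + En β Q h y) / 2
      - (Fintype.card ι : ℝ) * (α - K) / 8 * ∑ i, (x i - y i) ^ 2 := by
  have h1 : ∑ i, Q ((x i + y i) / 2) ≤ (∑ i, Q (x i) + ∑ i, Q (y i)) / 2
      - α / 8 * ∑ i, (x i - y i) ^ 2 := by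
    rw [← Finset.sum_add_distrib, Finset.sum_div, Finset.mul_sum, ← Finset.sum_sub_distrib]
    exact Finset.sum_le_sum fun i _ => P.Qmid _ _
  have h2 : ∑ i, ∑ j, WW β h ((x i + y i) / 2 - (x j + y j) / 2) ≤
      (∑ i, ∑ j, WW β h (x i - x j) + ∑ i, ∑ j, WW β h (y i - y j)) / 2
      + K / 8 * ∑ i, ∑ j, ((x i - y i) - (x j - y j)) ^ 2 := by
    simp only [← Finset.sum_add_distrib, Finset.sum_div, Finset.mul_sum]
    refine Finset.sum_le_sum fun i _ => Finset.sum_le_sum fun j _ => ?_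
    by_cases hij : i = j
    · subst hij; simp
    · have e : (x i + y i) / 2 - (x j + y j) / 2 = ((x i - x j) + (y i - y j)) / 2 := by ring
      rw [e]
      unfold WW
      have l := log_mid _ _ (hxy i j hij)
      have m := P.hmid (x i - x j) (y i - y j)
      have l' := mul_le_mul_of_nonneg_left l P.hβ.le
      have e2 : (x i - y i - (x j - y j)) ^ 2 = ((x i - x j) - (y i - y j)) ^ 2 := by ring
      rw [e2]
      linarith
  have h3 := pair_sq (fun i => x i - y i)
  have h3' := mul_le_mul_of_nonneg_left h3 (by linarith [P.hK] : (0:ℝ) ≤ K / 8)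
  have hn : (0 : ℝ) ≤ Fintype.card ι := by positivity
  have h1' := mul_le_mul_of_nonneg_left h1 hn
  unfold En
  linarith

lemma En_strong {β : ℝ} {Q h : ℝ → ℝ} {α K H : ℝ} (P : Hyp β Q h α K H)
    {ι : Type} [Fintype ι] (x y : ι → ℝ)
    (hxy : ∀ i j, i ≠ j → 0 < (x i - x j) * (y i - y j))
    (hmin : ∀ z : ι → ℝ, Function.Injective z → En β Q h x ≤ En β Q h z) :
    (Fintype.card ι : ℝ) * (α - K) / 4 * ∑ i, (x i - y i) ^ 2 ≤ En β Q h y - En β Q h x ∧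
    En β Q h (fun i => (x i + y i) / 2) ≤ En β Q h y
      - (Fintype.card ι : ℝ) * (α - K) / 4 * ∑ i, (x i - y i) ^ 2 := by
  have h1 := En_mid P x y hxy
  have h2 : En β Q h x ≤ En β Q h (fun i => (x i + y i) / 2) := by
    apply hmin
    intro i j hij
    by_contra hne
    have := hxy i j hne
    simp only at hij
    have e : x i - x j = -(y i - y j) := by linarith
    rw [e] at this
    nlinarith [sq_nonneg (y i - y j)]
  constructor <;> linarith

lemma WW_even {β : ℝ} {Q h : ℝ → ℝ} {α K H : ℝ} (P : Hyp β Q h α K H) (a b : ℝ) :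
    WW β h (a - b) = WW β h (b - a) := by
  unfold WW
  rw [← neg_sub b a, P.hev, Real.log_neg_eq_log]

lemma En_update {β : ℝ} {Q h : ℝ → ℝ} {α K H : ℝ} (P : Hyp β Q h α K H)
    {ι : Type} [Fintype ι] [DecidableEq ι] (x : ι → ℝ) (i : ι) (t : ℝ) :
    En β Q h (Function.update x i t) = En β Q h x + Fintype.card ι * (Q t - Q (x i)) +
      ∑ j ∈ univ.erase i, (WW β h (t - x j) - WW β h (x i - x j)) := by
  unfold En
  have split1 : ∀ f : ι → ℝ, ∑ j, f j = f i + ∑ j ∈ univ.erase i, f j := fun f =>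
    (Finset.add_sum_erase _ f (mem_univ i)).symm
  have split2 : ∀ f : ι → ι → ℝ, ∑ j, ∑ k, f j k =
      f i i + ∑ k ∈ univ.erase i, f i k + (∑ k ∈ univ.erase i, f k i +
        ∑ j ∈ univ.erase i, ∑ k ∈ univ.erase i, f j k) := by
    intro f
    rw [split1, split1 (f i), ← Finset.sum_add_distrib]
    congr 1
    exact Finset.sum_congr rfl fun j _ => split1 _
  rw [split1 (fun j => Q (Function.update x i t j)), split1 (fun j => Q (x j)),
    split2 (fun j k => WW β h (Function.update x i t j - Function.update x i t k)),
    split2 (fun j k => WW β h (x j - x k))]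
  simp only [Function.update_self]
  have e1 : ∑ j ∈ univ.erase i, Q (Function.update x i t j) = ∑ j ∈ univ.erase i, Q (x j) :=
    Finset.sum_congr rfl fun j hj => by rw [Function.update_of_ne (ne_of_mem_erase hj)]
  have e2 : ∑ k ∈ univ.erase i, WW β h (t - Function.update x i t k) =
      ∑ k ∈ univ.erase i, WW β h (t - x k) :=
    Finset.sum_congr rfl fun j hj => by rw [Function.update_of_ne (ne_of_mem_erase hj)]
  have e3 : ∑ k ∈ univ.erase i, WW β h (Function.update x i t k - t) =
      ∑ k ∈ univ.erase i, WW β h (t - x k) :=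
    Finset.sum_congr rfl fun j hj => by
      rw [Function.update_of_ne (ne_of_mem_erase hj), WW_even P]
  have e4 : ∑ j ∈ univ.erase i, ∑ k ∈ univ.erase i,
        WW β h (Function.update x i t j - Function.update x i t k) =
      ∑ j ∈ univ.erase i, ∑ k ∈ univ.erase i, WW β h (x j - x k) :=
    Finset.sum_congr rfl fun j hj => Finset.sum_congr rfl fun k hk => by
      rw [Function.update_of_ne (ne_of_mem_erase hj), Function.update_of_ne (ne_of_mem_erase hk)]
  have e5 : ∑ k ∈ univ.erase i, WW β h (x k - x i) = ∑ k ∈ univ.erase i, WW β h (x i - x k) :=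
    Finset.sum_congr rfl fun j hj => by rw [WW_even P]
  rw [e1, e2, e3, e4, e5, Finset.sum_sub_distrib]
  simp only [sub_self]
  ring

/-- counting: one coordinate -/
lemma count_one {κ : Type} [Fintype κ] [DecidableEq κ] (M : ℕ) [NeZero M] (i : κ)
    (g : Fin M → ℝ) :
    (M : ℝ) * ∑ a : κ → Fin M, g (a i) = (M : ℝ) ^ Fintype.card κ * ∑ b, g b := by
  have h1 : ∀ s : Fin M, ∑ a : κ → Fin M, g (a i) = ∑ a : κ → Fin M, g (a i + s) := by
    intro s
    rw [← Equiv.sum_comp (Equiv.addRight (fun _ : κ => s)) (fun a : κ → Fin M => g (a i))]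
    rfl
  have h2 : (M : ℝ) * ∑ a : κ → Fin M, g (a i) = ∑ s : Fin M, ∑ a : κ → Fin M, g (a i + s) := by
    rw [← Finset.sum_congr rfl (fun s _ => h1 s)]
    simp
  rw [h2, Finset.sum_comm]
  have h3 : ∀ a : κ → Fin M, ∑ s, g (a i + s) = ∑ b, g b := fun a =>
    Equiv.sum_comp (Equiv.addLeft (a i)) g
  simp [h3]

lemma count_two {κ : Type} [Fintype κ] [DecidableEq κ] (M : ℕ) [NeZero M] (i j : κ)
    (hij : i ≠ j) (g : Fin M → Fin M → ℝ) :
    (M : ℝ) ^ 2 * ∑ a : κ → Fin M, g (a i) (a j) =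
      (M : ℝ) ^ Fintype.card κ * ∑ b, ∑ c, g b c := by
  have h1 : ∀ s t : Fin M, ∑ a : κ → Fin M, g (a i) (a j) =
      ∑ a : κ → Fin M, g (a i + s) (a j + t) := by
    intro s t
    rw [← Equiv.sum_comp (Equiv.addRight (fun k : κ => if k = i then s else t))
      (fun a : κ → Fin M => g (a i) (a j))]
    simp [hij.symm]
  have h2 : (M : ℝ) ^ 2 * ∑ a : κ → Fin M, g (a i) (a j) =
      ∑ s : Fin M, ∑ t : Fin M, ∑ a : κ → Fin M, g (a i + s) (a j + t) := by
    rw [← Finset.sum_congr rfl (fun s _ => Finset.sum_congr rfl (fun t _ => h1 s t))]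
    simp
    ring
  have h3 : ∀ a : κ → Fin M, ∑ s, ∑ t, g (a i + s) (a j + t) = ∑ b, ∑ c, g b c := by
    intro a
    rw [← Equiv.sum_comp (Equiv.addLeft (a i)) (fun b => ∑ c, g b c)]
    refine Finset.sum_congr rfl fun s _ => ?_
    exact Equiv.sum_comp (Equiv.addLeft (a j)) (g (a i + s))
  rw [h2]
  have : ∑ s : Fin M, ∑ t : Fin M, ∑ a : κ → Fin M, g (a i + s) (a j + t) =
      ∑ a : κ → Fin M, ∑ s : Fin M, ∑ t : Fin M, g (a i + s) (a j + t) := by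
    rw [Finset.sum_comm' (t' := univ) (s' := fun _ => univ) (by simp)]
    rw [Finset.sum_congr rfl (fun t _ => Finset.sum_comm)]
    rw [Finset.sum_comm]
    refine Finset.sum_congr rfl fun a _ => Finset.sum_comm
  rw [this]
  simp [h3]

lemma pairSum_eq {N : ℕ} (g : ℝ → ℝ) (hg : ∀ t, g (-t) = g t) (x : Fin N → ℝ) :
    pairSum g x = 1 / 2 * (∑ i, ∑ j, g (x i - x j)) - N * g 0 / 2 := by
  have key : ∑ i, ∑ j, g (x i - x j) = pairSum g x + pairSum g x + N * g 0 := by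
    have h1 : pairSum g x = ∑ i, ∑ j, if i < j then g (x i - x j) else 0 := by
      unfold pairSum
      rw [Finset.sum_filter, Fintype.sum_prod_type]
    have h2 : pairSum g x = ∑ i, ∑ j, if j < i then g (x i - x j) else 0 := by
      rw [h1, Finset.sum_comm]
      refine Finset.sum_congr rfl fun i _ => Finset.sum_congr rfl fun j _ => ?_
      rw [← hg (x i - x j), neg_sub]
    have h3 : (N : ℝ) * g 0 = ∑ i : Fin N, ∑ j : Fin N, if i = j then g (x i - x j) else 0 := by
      simp
    nth_rewrite 1 [h1]
    rw [h2, h3, ← Finset.sum_add_distrib, ← Finset.sum_add_distrib]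
    refine Finset.sum_congr rfl fun i _ => ?_
    rw [← Finset.sum_add_distrib, ← Finset.sum_add_distrib]
    refine Finset.sum_congr rfl fun j _ => ?_
    rcases lt_trichotomy i j with hij | hij | hij
    · simp [hij, hij.not_gt, hij.ne]
    · simp [hij]
    · simp [hij, hij.not_gt, hij.ne']
  linarith

lemma weight_inj {β : ℝ} {Q h : ℝ → ℝ} {α K H : ℝ} (P : Hyp β Q h α K H) {N : ℕ}
    (x : Fin N → ℝ) (hx : Function.Injective x) :
    weightH β Q h N x = Real.exp (N * h 0 / 2 - En β Q h x) := by
  have hv : vdm β x = Real.exp (β * pairSum Real.log x) := by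
    unfold vdm pairSum
    rw [Finset.mul_sum, Real.exp_sum]
    refine Finset.prod_congr rfl fun p hp => ?_
    have : x p.1 - x p.2 ≠ 0 := sub_ne_zero.2 (fun h => by
      have := hx h
      simp [this] at hp)
    rw [Real.rpow_def_of_pos (abs_pos.2 this), Real.log_abs, mul_comm]
  unfold weightH
  rw [hv, ← Real.exp_add, pairSum_eq h P.hev, pairSum_eq Real.log (fun t => Real.log_neg_eq_log t)]
  congr 1
  unfold En WW
  simp only [Finset.sum_sub_distrib, ← Finset.mul_sum, Fintype.card_fin, Real.log_zero]
  ring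

lemma weight_noninj {β : ℝ} (hβ : 0 < β) (Q h : ℝ → ℝ) {N : ℕ}
    (x : Fin N → ℝ) (hx : ¬ Function.Injective x) : weightH β Q h N x = 0 := by
  unfold weightH
  have : vdm β x = 0 := by
    rw [Function.not_injective_iff] at hx
    obtain ⟨a, b, hab, hne⟩ := hx
    unfold vdm
    rcases lt_or_gt_of_ne hne with hl | hl
    · exact Finset.prod_eq_zero (i := (a, b)) (by simp [hl]) (by simp [hab, Real.zero_rpow hβ.ne'])
    · exact Finset.prod_eq_zero (i := (b, a)) (by simp [hl]) (by simp [hab, Real.zero_rpow hβ.ne'])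
  rw [this, zero_mul]

lemma weight_nonneg (β : ℝ) (Q h : ℝ → ℝ) {N : ℕ} (x : Fin N → ℝ) : 0 ≤ weightH β Q h N x := by
  unfold weightH vdm
  exact mul_nonneg (Finset.prod_nonneg fun p _ => Real.rpow_nonneg (abs_nonneg _) _)
    (Real.exp_pos _).le

lemma weight_continuous {β : ℝ} {Q h : ℝ → ℝ} {α K H : ℝ} (P : Hyp β Q h α K H) (N : ℕ) :
    Continuous (weightH β Q h N) := by
  have hq := P.Qdiff.continuous
  have hh := P.hdiff.continuous
  unfold weightH vdm pairSum
  refine Continuous.mul ?_ (by fun_prop)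
  refine continuous_finsetProd _ fun p _ => ?_
  exact Continuous.rpow_const (by fun_prop) (fun _ => Or.inr P.hβ.le)

lemma Q_lower {β : ℝ} {Q h : ℝ → ℝ} {α K H : ℝ} (P : Hyp β Q h α K H) (t : ℝ) :
    Q 0 + α / 2 * t ^ 2 ≤ Q t := by
  have := P.Qmid t (-t)
  rw [P.Qev] at this
  simp at this
  nlinarith

lemma En_lower {β : ℝ} {Q h : ℝ → ℝ} {α K H : ℝ} (P : Hyp β Q h α K H) {N : ℕ}
    (x : Fin N → ℝ) :
    - En β Q h x ≤ ∑ i, (N : ℝ) * ((- Q 0 + H / 2 + β ^ 2 / α) - α / 4 * x i ^ 2) := by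
  have hα : 0 < α := P.hK.trans_lt P.hαK
  have hW : ∀ i j, - WW β h (x i - x j) ≤ H + β * (|x i| + |x j|) := by
    intro i j
    unfold WW
    have h1 := (abs_le.1 (P.hH (x i - x j))).1
    have h2 : Real.log (x i - x j) ≤ |x i| + |x j| := by
      rw [← Real.log_abs]
      exact (Real.log_le_self (abs_nonneg _)).trans (abs_sub _ _)
    have := mul_le_mul_of_nonneg_left h2 P.hβ.le
    linarith
  have h1 : - ∑ i, ∑ j, WW β h (x i - x j) ≤ N * ∑ i : Fin N, (H + 2 * β * |x i|) := by
    rw [← Finset.sum_neg_distrib]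
    calc _ ≤ ∑ i, ∑ j, (H + β * (|x i| + |x j|)) := by
          refine Finset.sum_le_sum fun i _ => ?_
          rw [← Finset.sum_neg_distrib]
          exact Finset.sum_le_sum fun j _ => hW i j
      _ = _ := by
          simp only [Finset.sum_add_distrib, ← Finset.mul_sum, mul_add, Finset.sum_const,
            Finset.card_univ, Fintype.card_fin, nsmul_eq_mul]
          ring
  have h2 : ∑ i, (N : ℝ) * (- Q (x i) + H / 2 + β * |x i|) ≤
      ∑ i, (N : ℝ) * ((- Q 0 + H / 2 + β ^ 2 / α) - α / 4 * x i ^ 2) := by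
    refine Finset.sum_le_sum fun i _ => mul_le_mul_of_nonneg_left ?_ (by positivity)
    have := Q_lower P (x i)
    have h3 : β * |x i| ≤ β ^ 2 / α + α / 4 * x i ^ 2 := by
      have : β ^ 2 / α + α / 4 * x i ^ 2 - β * |x i| = (β - α / 2 * |x i|) ^ 2 / α := by
        rw [← sq_abs (x i)]
        field_simp
        ring
      have h4 : 0 ≤ (β - α / 2 * |x i|) ^ 2 / α := by positivity
      linarith
    linarith
  refine le_trans ?_ h2
  unfold En
  simp only [Fintype.card_fin]
  rw [← Finset.mul_sum]
  simp only [Finset.sum_add_distrib, Finset.sum_neg_distrib, mul_add, ← Finset.mul_sum] at h1 ⊢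
  rw [← Finset.sum_div]
  nlinarith

lemma weight_le {β : ℝ} {Q h : ℝ → ℝ} {α K H : ℝ} (P : Hyp β Q h α K H) {N : ℕ}
    (x : Fin N → ℝ) : weightH β Q h N x ≤ Real.exp (N * h 0 / 2) *
      ∏ i, Real.exp ((N : ℝ) * ((- Q 0 + H / 2 + β ^ 2 / α) - α / 4 * x i ^ 2)) := by
  rw [← Real.exp_sum, ← Real.exp_add]
  by_cases hx : Function.Injective x
  · rw [weight_inj P x hx]
    apply Real.exp_le_exp.2
    have := En_lower P x
    linarith
  · rw [weight_noninj P.hβ Q h x hx]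
    exact (Real.exp_pos _).le

lemma weight_integrable {β : ℝ} {Q h : ℝ → ℝ} {α K H : ℝ} (P : Hyp β Q h α K H) (N : ℕ)
    (hN : 0 < N) : Integrable (weightH β Q h N) := by
  have hα : 0 < α := P.hK.trans_lt P.hαK
  have hN' : (0 : ℝ) < N := by exact_mod_cast hN
  have hg : Integrable (fun t : ℝ =>
      Real.exp ((N : ℝ) * ((- Q 0 + H / 2 + β ^ 2 / α) - α / 4 * t ^ 2))) := by
    have h1 := (integrable_exp_neg_mul_sq (b := N * (α / 4)) (by positivity)).const_mul
      (Real.exp ((N : ℝ) * (- Q 0 + H / 2 + β ^ 2 / α)))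
    refine h1.congr (ae_of_all _ fun t => ?_)
    simp only
    rw [← Real.exp_add]
    congr 1
    ring
  have hg2 : Integrable (fun x : Fin N → ℝ =>
      ∏ i, Real.exp ((N : ℝ) * ((- Q 0 + H / 2 + β ^ 2 / α) - α / 4 * x i ^ 2))) :=
    Integrable.fintype_prod (fun _ => hg)
  refine (hg2.const_mul (Real.exp (N * h 0 / 2))).mono'
    (weight_continuous P N).aestronglyMeasurable (ae_of_all _ fun x => ?_)
  rw [Real.norm_of_nonneg (weight_nonneg _ _ _ x)]
  exact weight_le P x

lemma weight_pos {β : ℝ} {Q h : ℝ → ℝ} {α K H : ℝ} (P : Hyp β Q h α K H) (N : ℕ) :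
    0 < weightH β Q h N (fun i => (i : ℝ)) := by
  rw [weight_inj P]
  · exact Real.exp_pos _
  · intro i j hij
    simpa [Fin.ext_iff] using hij

lemma ZH_pos {β : ℝ} {Q h : ℝ → ℝ} {α K H : ℝ} (P : Hyp β Q h α K H) (N : ℕ)
    (hN : 0 < N) : 0 < ZH β Q h N := by
  unfold ZH
  rw [integral_pos_iff_support_of_nonneg (fun x => weight_nonneg _ _ _ x)
    (weight_integrable P N hN)]
  apply IsOpen.measure_pos
  · exact (weight_continuous P N).isOpen_support
  · exact ⟨_, (weight_pos P N).ne'⟩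

lemma exists_min {β : ℝ} {Q h : ℝ → ℝ} {α K H : ℝ} (P : Hyp β Q h α K H) (N : ℕ)
    (hN : 0 < N) : ∃ x : Fin N → ℝ, StrictMono x ∧
      ∀ z : Fin N → ℝ, Function.Injective z → En β Q h x ≤ En β Q h z := by
  have hα : 0 < α := P.hK.trans_lt P.hαK
  have hN' : (0 : ℝ) < N := by exact_mod_cast hN
  set C := (- Q 0 + H / 2 + β ^ 2 / α)
  have ht : Tendsto (fun x : Fin N → ℝ => Real.exp (N * h 0 / 2 + N * N * C
      - N * (α / 4) * ‖x‖ ^ 2)) (cocompact _) (𝓝 0) := by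
    apply Real.tendsto_exp_atBot.comp
    apply tendsto_atBot_add_const_left
    rw [tendsto_neg_atBot_iff]
    apply Tendsto.const_mul_atTop (by positivity)
    exact (tendsto_pow_atTop (by norm_num)).comp tendsto_norm_cocompact_atTop
  obtain ⟨y, hy⟩ := (weight_continuous P N).exists_forall_ge' (fun i => (i : ℝ)) (by
    filter_upwards [ht.eventually (eventually_lt_nhds (weight_pos P N))] with x hx
    refine le_trans ((weight_le P x).trans ?_) hx.le
    rw [← Real.exp_sum, ← Real.exp_add]
    apply Real.exp_le_exp.2
    rw [← Finset.mul_sum, Finset.sum_sub_distrib]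
    simp only [Finset.sum_const, Finset.card_univ, Fintype.card_fin, nsmul_eq_mul,
      ← Finset.mul_sum]
    have hs : ‖x‖ ^ 2 ≤ ∑ i, x i ^ 2 := by
      have : ‖x‖ ≤ Real.sqrt (∑ i, x i ^ 2) := by
        rw [pi_norm_le_iff_of_nonneg (Real.sqrt_nonneg _)]
        intro i
        apply Real.le_sqrt_of_sq_le
        rw [Real.norm_eq_abs, sq_abs]
        exact Finset.single_le_sum (f := fun i => x i ^ 2) (fun i _ => sq_nonneg _) (mem_univ i)
      calc ‖x‖ ^ 2 ≤ (Real.sqrt (∑ i, x i ^ 2)) ^ 2 := by gcongr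
        _ = _ := Real.sq_sqrt (Finset.sum_nonneg fun i _ => sq_nonneg _)
    have := mul_le_mul_of_nonneg_left hs (by positivity : 0 ≤ N * (α / 4))
    simp only [C] at *
    linarith)
  have hyinj : Function.Injective y := by
    by_contra hc
    have := hy (fun i => (i : ℝ))
    rw [weight_noninj P.hβ Q h y hc] at this
    exact absurd (weight_pos P N) (not_lt.2 this)
  have hmin : ∀ z : Fin N → ℝ, Function.Injective z → En β Q h y ≤ En β Q h z := by
    intro z hz
    have := hy z
    rw [weight_inj P y hyinj, weight_inj P z hz, Real.exp_le_exp] at this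
    linarith
  refine ⟨fun i => y (Tuple.sort y i), ?_, ?_⟩
  · exact (Tuple.monotone_sort y).strictMono_of_injective
      (hyinj.comp (Tuple.sort y).injective)
  · intro z hz
    rw [En_comp β Q h (Tuple.sort y) y]
    exact hmin z hz

def IsMinC (β : ℝ) (Q h : ℝ → ℝ) {N : ℕ} (x : Fin N → ℝ) : Prop :=
  StrictMono x ∧ ∀ z : Fin N → ℝ, Function.Injective z → En β Q h x ≤ En β Q h z

lemma mul_log_ge (u : ℝ) (hu : 0 ≤ u) : -1 ≤ u * Real.log u := by
  rcases hu.eq_or_lt with rfl | hu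
  · simp
  · have := Real.one_sub_inv_le_log_of_pos hu
    have h2 := mul_le_mul_of_nonneg_left this hu.le
    have : u * (1 - u⁻¹) = u - 1 := by field_simp
    linarith

lemma integral_log_ge (s : ℝ) : -3 ≤ ∫ t in (0:ℝ)..1, Real.log (t - s) := by
  rw [intervalIntegral.integral_comp_sub_right (fun t => Real.log t) s, integral_log]
  have e : Real.log (0 - s) = Real.log s := by rw [zero_sub, Real.log_neg_eq_log]
  rw [e]
  rcases lt_or_ge s 0 with hs | hs
  · have h1 : Real.log s = Real.log (-s) := (Real.log_neg_eq_log s).symm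
    rw [h1]
    have h2 : Real.log (-s) ≤ Real.log (1 - s) := Real.log_le_log (by linarith) (by linarith)
    have h3 := Real.log_nonneg (by linarith : (1:ℝ) ≤ 1 - s)
    nlinarith
  rcases le_or_gt s 1 with hs1 | hs1
  · have h1 := mul_log_ge s hs
    have h2 := mul_log_ge (1 - s) (by linarith)
    linarith
  · have h1 : Real.log (1 - s) = Real.log (s - 1) := by
      rw [← Real.log_neg_eq_log, neg_sub]
    rw [h1]
    have h2 : Real.log (s - 1) ≤ Real.log s := Real.log_le_log (by linarith) (by linarith)
    have h3 := Real.log_nonneg hs1.le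
    nlinarith

lemma exists_good_t {N : ℕ} (x : Fin N → ℝ) (S : Finset (Fin N)) :
    ∃ t : ℝ, 0 ≤ t ∧ t ≤ 1 ∧ (∀ j, t ≠ x j) ∧ ∑ j ∈ S, - Real.log (t - x j) ≤ 3 * N := by
  have hIntg : ∀ j, IntervalIntegrable (fun t => Real.log (t - x j)) volume 0 1 := fun j => by
    have := (intervalIntegral.intervalIntegrable_log' (a := 0 - x j) (b := 1 - x j)).comp_sub_right
      (x j)
    simpa using this
  let ν : Measure ℝ := volume.restrict (Set.Ioc 0 1)
  haveI : IsProbabilityMeasure ν := ⟨by simp [ν]⟩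
  have hnull : ν ((Set.Ioc 0 1)ᶜ ∪ Set.range x) = 0 := by
    apply measure_union_null
    · simp [ν, Measure.restrict_apply measurableSet_Ioc.compl]
    · exact (Set.finite_range x).measure_zero _
  have hi : Integrable (fun t => ∑ j ∈ S, - Real.log (t - x j)) ν := by
    refine integrable_finsetSum _ fun j _ => ?_
    exact ((intervalIntegrable_iff_integrableOn_Ioc_of_le zero_le_one).1 (hIntg j)).neg
  obtain ⟨t, ht, hle⟩ := exists_notMem_null_le_integral hi hnull
  have ht' : t ∈ Set.Ioc (0:ℝ) 1 := by
    by_contra hc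
    exact ht (Or.inl hc)
  refine ⟨t, ht'.1.le, ht'.2, fun j hj => ht (Or.inr ⟨j, hj.symm⟩), hle.trans ?_⟩
  rw [integral_finsetSum]
  · have h1 : ∀ j ∈ S, ∫ t, - Real.log (t - x j) ∂ν ≤ 3 := by
      intro j _
      rw [integral_neg]
      have := integral_log_ge (x j)
      rw [intervalIntegral.integral_of_le zero_le_one] at this
      linarith
    refine (Finset.sum_le_sum h1).trans ?_
    rw [Finset.sum_const, nsmul_eq_mul]
    have : (S.card : ℝ) ≤ N := by
      have := Finset.card_le_univ S
      rw [Fintype.card_fin] at this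
      exact_mod_cast this
    linarith
  · intro j _
    exact ((intervalIntegrable_iff_integrableOn_Ioc_of_le zero_le_one).1 (hIntg j)).neg

lemma update_inj {N : ℕ} (x : Fin N → ℝ) (hx : Function.Injective x) (i : Fin N) (t : ℝ)
    (ht : ∀ j, j ≠ i → t ≠ x j) : Function.Injective (Function.update x i t) := by
  intro a b hab
  by_cases ha : a = i <;> by_cases hb : b = i
  · rw [ha, hb]
  · subst ha
    rw [Function.update_self, Function.update_of_ne hb] at hab
    exact absurd hab (ht b hb)
  · subst hb
    rw [Function.update_self, Function.update_of_ne ha] at hab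
    exact absurd hab.symm (ht a ha)
  · rw [Function.update_of_ne ha, Function.update_of_ne hb] at hab
    exact hx hab

lemma move_nonneg {β : ℝ} {Q h : ℝ → ℝ} {α K H : ℝ} (P : Hyp β Q h α K H) {N : ℕ}
    (x : Fin N → ℝ) (hx : IsMinC β Q h x) (i : Fin N) (t : ℝ) (ht : ∀ j, j ≠ i → t ≠ x j) :
    0 ≤ (N : ℝ) * (Q t - Q (x i)) +
      ∑ j ∈ univ.erase i, (WW β h (t - x j) - WW β h (x i - x j)) := by
  have h1 := hx.2 _ (update_inj x hx.1.injective i t ht)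
  rw [En_update P, Fintype.card_fin] at h1
  linarith

lemma min_bounded {β : ℝ} {Q h : ℝ → ℝ} {α K H : ℝ} (P : Hyp β Q h α K H) :
    ∃ R : ℝ, 0 < R ∧ ∀ (N : ℕ) (x : Fin N → ℝ), IsMinC β Q h x → ∀ i, |x i| ≤ R := by
  have hα : 0 < α := P.hK.trans_lt P.hαK
  have hH : 0 ≤ H := (abs_nonneg _).trans (P.hH 0)
  obtain ⟨B, hB⟩ := (isCompact_Icc (a := (0:ℝ)) (b := 1)).exists_bound_of_continuousOn
      P.Qdiff.continuous.continuousOn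
  set D := B + |Q 0| + 2 * H + 3 * β with hD
  have hB0 : 0 ≤ B := (norm_nonneg _).trans (hB 0 (by simp))
  have hD0 : 0 ≤ D := by have := P.hβ; positivity
  refine ⟨1 + 2 / α * (D + 2 * β), by have := P.hβ; positivity, fun N x hx i' => ?_⟩
  obtain ⟨i, -, hi⟩ := Finset.exists_max_image univ (fun i => |x i|) ⟨i', mem_univ _⟩
  refine (hi i' (mem_univ _)).trans ?_
  obtain ⟨t, ht0, ht1, htx, hts⟩ := exists_good_t x (univ.erase i)
  have hm := move_nonneg P x hx i t (fun j _ => htx j)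
  set r := |x i| with hr
  have hr0 : 0 ≤ r := abs_nonneg _
  have hN : (0:ℝ) < N := by
    have : 0 < N := Fin.pos i
    exact_mod_cast this
  have hterm : ∑ j ∈ univ.erase i, (WW β h (t - x j) - WW β h (x i - x j)) ≤
      ∑ j ∈ univ.erase i, (2 * H + 2 * β * r) + β * (3 * N) := by
    refine le_trans ?_ (add_le_add le_rfl (mul_le_mul_of_nonneg_left hts P.hβ.le))
    rw [Finset.mul_sum, ← Finset.sum_add_distrib]
    refine Finset.sum_le_sum fun j _ => ?_
    unfold WW
    have h1 := (abs_le.1 (P.hH (t - x j))).2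
    have h2 := (abs_le.1 (P.hH (x i - x j))).1
    have h3 : Real.log (x i - x j) ≤ 2 * r := by
      rw [← Real.log_abs]
      refine (Real.log_le_self (abs_nonneg _)).trans ((abs_sub _ _).trans ?_)
      linarith [hi j (mem_univ _)]
    have h4 := mul_le_mul_of_nonneg_left h3 P.hβ.le
    linarith
  have hcard : ∑ j ∈ univ.erase i, (2 * H + 2 * β * r) ≤ N * (2 * H + 2 * β * r) := by
    rw [Finset.sum_const, nsmul_eq_mul]
    have hc : ((univ.erase i).card : ℝ) ≤ N := by
      have := Finset.card_le_univ (univ.erase i)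
      rw [Fintype.card_fin] at this
      exact_mod_cast this
    exact mul_le_mul_of_nonneg_right hc (by have := P.hβ; positivity)
  have hQt : Q t ≤ B := (le_abs_self _).trans (hB t ⟨ht0, ht1⟩)
  have hQx := Q_lower P (x i)
  have hsum : 0 ≤ (N : ℝ) * (Q t - Q (x i) + 2 * H + 2 * β * r + 3 * β) := by linarith
  have hsum' := nonneg_of_mul_nonneg_right hsum hN
  have hfin : α / 2 * r ^ 2 ≤ D + 2 * β * r := by
    rw [hr, sq_abs]
    have := neg_abs_le (Q 0)
    linarith
  by_contra hcon
  push Not at hcon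
  have hr1 : 1 < r := by
    refine lt_of_le_of_lt ?_ hcon
    have : 0 ≤ 2 / α * (D + 2 * β) := by have := P.hβ; positivity
    linarith
  have h5 : α / 2 * r ≤ D + 2 * β := by
    by_contra h6
    push Not at h6
    have := mul_lt_mul_of_pos_right h6 (by linarith : 0 < r)
    nlinarith
  have h7 : r ≤ 2 / α * (D + 2 * β) := by
    rw [div_mul_eq_mul_div, le_div_iff₀ hα]
    linarith
  linarith

lemma deriv_h_zero {β : ℝ} {Q h : ℝ → ℝ} {α K H : ℝ} (P : Hyp β Q h α K H) : deriv h 0 = 0 := by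
  have h1 : (fun t => h (-t)) = h := funext P.hev
  have h2 := deriv_comp_neg h 0
  rw [h1] at h2
  simp at h2
  linarith

lemma crit {β : ℝ} {Q h : ℝ → ℝ} {α K H : ℝ} (P : Hyp β Q h α K H) {N : ℕ}
    (x : Fin N → ℝ) (hx : IsMinC β Q h x) (i : Fin N) :
    (N : ℝ) * deriv Q (x i) + ∑ j, (deriv h (x i - x j) - β * (1 / (x i - x j))) = 0 := by
  set φ : ℝ → ℝ := fun t => (N : ℝ) * (Q t - Q (x i)) +
      ∑ j ∈ univ.erase i, (WW β h (t - x j) - WW β h (x i - x j)) with hφ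
  have hmin : IsLocalMin φ (x i) := by
    have hev : ∀ᶠ t in 𝓝 (x i), ∀ j, j ≠ i → t ≠ x j := by
      rw [eventually_all]
      intro j
      by_cases hj : j = i
      · simp [hj]
      · have : x i ≠ x j := fun hh => hj (hx.1.injective hh).symm
        filter_upwards [isOpen_ne.mem_nhds this] with t ht _
        exact ht
    filter_upwards [hev] with t ht
    have h0 : φ (x i) = 0 := by simp [hφ]
    rw [h0]
    exact move_nonneg P x hx i t ht
  have hder : HasDerivAt φ ((N : ℝ) * deriv Q (x i) +
      ∑ j ∈ univ.erase i, (deriv h (x i - x j) - β * (1 / (x i - x j)))) (x i) := by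
    refine HasDerivAt.add ?_ ?_
    · exact ((P.Qdiff (x i)).hasDerivAt.sub_const _).const_mul _
    · refine HasDerivAt.fun_sum fun j hj => ?_
      refine HasDerivAt.sub_const _ ?_
      unfold WW
      have hne : x i - x j ≠ 0 :=
        sub_ne_zero.2 (fun hh => (ne_of_mem_erase hj) (hx.1.injective hh).symm)
      have hid : HasDerivAt (fun t => t - x j) 1 (x i) := (hasDerivAt_id _).sub_const _
      refine HasDerivAt.sub ?_ (HasDerivAt.const_mul _ ?_)
      · have := HasDerivAt.comp (x i) (P.hdiff (x i - x j)).hasDerivAt hid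
        simpa [Function.comp_def] using this
      · exact hid.log hne
  have h0 := hmin.hasDerivAt_eq_zero hder
  rw [← Finset.add_sum_erase _ _ (mem_univ i)]
  simp only [sub_self, deriv_h_zero P]
  simpa using h0

lemma gap_term (k j : ℕ) (d u v : ℝ) (hd : 0 < d) (huv : u = v + d)
    (h1 : j < k → ((k : ℝ) - j) * d ≤ v) (h2 : j = k → v = 0) (h3 : j = k + 1 → u = 0)
    (h4 : k + 1 < j → ((j : ℝ) - (k + 1)) * d ≤ - u) :
    1 / ((k : ℝ) + 1 - j) - 1 / ((k : ℝ) + 1 - (j + 1 : ℕ)) ≤ d * (1 / u - 1 / v) := by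
  have aux : ∀ m w : ℝ, 0 < m → m * d ≤ w → 1 / (m + 1) - 1 / m ≤ d * (1 / (w + d) - 1 / w) := by
    intro m w hm hw
    have hw0 : 0 < w := lt_of_lt_of_le (by positivity) hw
    have e1 : 1 / (m + 1) - 1 / m = - (1 / (m * (m + 1))) := by field_simp; ring
    have e2 : d * (1 / (w + d) - 1 / w) = - (d ^ 2 / (w * (w + d))) := by field_simp; ring
    rw [e1, e2]
    apply neg_le_neg
    rw [div_le_div_iff₀ (by positivity) (by positivity)]
    have : m * d * (m * d + d) ≤ w * (w + d) := by gcongr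
    nlinarith
  push_cast
  rcases lt_trichotomy j k with hjk | hjk | hjk
  · have hpos : (0:ℝ) < (k:ℝ) - j := by
      have : (j:ℝ) < k := by exact_mod_cast hjk
      linarith
    have := aux ((k:ℝ) - j) v hpos (h1 hjk)
    rw [huv]
    convert this using 2
    · congr 1; ring
    · congr 1; ring
  · rw [h2 hjk, zero_add] at huv
    rw [h2 hjk, huv, hjk]
    simp [hd.ne']
  · rcases eq_or_lt_of_le (Nat.succ_le_of_lt hjk) with hj1 | hj1
    · have hu := h3 hj1.symm
      have hv : v = -d := by linarith
      rw [hu, hv, ← hj1]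
      push_cast
      simp [hd.ne']
    · have hpos : (0:ℝ) < (j:ℝ) - (k + 1) := by
        have : ((k + 1 : ℕ):ℝ) < j := by exact_mod_cast hj1
        push_cast at this
        linarith
      have := aux ((j:ℝ) - (k + 1)) (-u) hpos (h4 hj1)
      have hv : v = -(-u + d) := by linarith
      rw [hv]
      have e1 : (k:ℝ) + 1 - j = - ((j:ℝ) - (k+1)) := by ring
      have e2 : (k:ℝ) + 1 - (j + 1) = - ((j:ℝ) - (k+1) + 1) := by ring
      rw [e1, e2]
      simp only [one_div, inv_neg] at this ⊢
      linarith

lemma min_gap {β : ℝ} {Q h : ℝ → ℝ} {α K H : ℝ} (P : Hyp β Q h α K H) :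
    ∃ C : ℝ, 0 < C ∧ ∀ (N : ℕ) (x : Fin N → ℝ), IsMinC β Q h x →
      ∀ i j, i < j → C / N ≤ x j - x i := by
  obtain ⟨R, hR, hb⟩ := min_bounded P
  obtain ⟨L, hL0, hL⟩ := P.Qd R
  have hKL : 0 < L + K + 1 := by have := P.hK; positivity
  have hβ := P.hβ
  refine ⟨Real.sqrt (2 * β / (L + K + 1)), by positivity, fun N x hx i j hij => ?_⟩
  have hN2 : 2 ≤ N := by
    have h1 := j.isLt
    have h2 : (i:ℕ) < j := hij
    omega
  have hNpos : (0:ℝ) < N := by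
    have : 0 < N := by omega
    exact_mod_cast this
  set X : ℕ → ℝ := fun n => if hn : n < N then x ⟨n, hn⟩ else 0 with hX
  have hXx : ∀ i : Fin N, X i = x i := fun i => by simp [hX]
  obtain ⟨k, hk, hkmin⟩ := Finset.exists_min_image (Finset.range (N - 1))
    (fun n => X (n + 1) - X n) ⟨0, by simp; omega⟩
  have hk1 : k + 1 < N := by have := Finset.mem_range.1 hk; omega
  set d := X (k + 1) - X k with hd
  have hd0 : 0 < d := by
    have : X k < X (k+1) := by
      simp only [hX, hk1, (by omega : k < N), dif_pos]
      exact hx.1 (by simp [Fin.lt_def])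
    linarith
  have hgap : ∀ m l : ℕ, m + l < N → (l : ℝ) * d ≤ X (m + l) - X m := by
    intro m l
    induction l with
    | zero => intro _; simp
    | succ l ih =>
      intro hl
      have h1 := ih (by omega)
      have h2 := hkmin (m + l) (Finset.mem_range.2 (by omega))
      push_cast
      rw [← add_assoc]
      linarith
  have hgap' : ∀ m n : ℕ, m ≤ n → n < N → ((n : ℝ) - m) * d ≤ X n - X m := by
    intro m n hmn hn
    obtain ⟨l, rfl⟩ := Nat.exists_eq_add_of_le hmn
    have := hgap m l hn
    push_cast
    linarith
  set a : Fin N := ⟨k, by omega⟩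
  set b : Fin N := ⟨k + 1, hk1⟩
  have hxa : x a = X k := (hXx a).symm
  have hxb : x b = X (k + 1) := (hXx b).symm
  have hca := crit P x hx a
  have hcb := crit P x hx b
  have hq : deriv Q (x b) - deriv Q (x a) ≤ L * d := by
    have := (hL (x b) (x a) (hb N x hx b) (hb N x hx a)).1
    rw [hxa, hxb, ← hd, abs_of_pos hd0] at this
    rw [hxa, hxb]
    exact (le_abs_self _).trans this
  have hh : ∑ j, deriv h (x b - x j) - ∑ j, deriv h (x a - x j) ≤ N * (K * d) := by
    rw [← Finset.sum_sub_distrib]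
    have : ∀ j ∈ (univ : Finset (Fin N)), deriv h (x b - x j) - deriv h (x a - x j) ≤ K * d := by
      intro j _
      have := P.hd (x b - x j) (x a - x j)
      rw [show x b - x j - (x a - x j) = d by rw [hxa, hxb]; ring, abs_of_pos hd0] at this
      exact (le_abs_self _).trans this
    refine (Finset.sum_le_sum this).trans ?_
    simp
  have hs : 2 / (N:ℝ) ≤ d * (∑ j, 1 / (x b - x j) - ∑ j, 1 / (x a - x j)) := by
    rw [← Finset.sum_sub_distrib, Finset.mul_sum]
    have h1 : ∑ j : Fin N, (1 / ((k : ℝ) + 1 - (j:ℕ)) - 1 / ((k : ℝ) + 1 - ((j:ℕ) + 1 : ℕ))) ≤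
        ∑ j, d * (1 / (x b - x j) - 1 / (x a - x j)) := by
      refine Finset.sum_le_sum fun j _ => ?_
      refine gap_term k j d _ _ hd0 ?_ ?_ ?_ ?_ ?_
      · rw [hxa, hxb]; ring
      · intro hj
        rw [hxa, ← hXx j]
        exact hgap' j k hj.le (by omega)
      · intro hj
        rw [hxa, ← hXx j, hj, sub_self]
      · intro hj
        rw [hxb, ← hXx j, hj, sub_self]
      · intro hj
        rw [hxb, ← hXx j, neg_sub]
        have := hgap' (k+1) j hj.le j.isLt
        push_cast at this
        exact this
    refine le_trans ?_ h1
    rw [Fin.sum_univ_eq_sum_range (fun j : ℕ => 1 / ((k : ℝ) + 1 - (j:ℕ))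
      - 1 / ((k : ℝ) + 1 - (j + 1 : ℕ))) N,
      Finset.sum_range_sub' (fun j : ℕ => 1 / ((k : ℝ) + 1 - (j:ℕ)))]
    have hkN : ((k:ℝ) + 1) < N := by exact_mod_cast hk1
    have e : (1:ℝ) / ((k:ℝ) + 1 - N) = - (1 / (N - (k + 1))) := by
      rw [← neg_sub, one_div, inv_neg, one_div]
    rw [e]
    have h2 : 1 / (N:ℝ) ≤ 1 / ((k:ℝ) + 1 - (0:ℕ)) := by
      apply one_div_le_one_div_of_le
      · push_cast
        have : (0:ℝ) ≤ k := by positivity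
        linarith
      · push_cast; linarith
    have h3 : 1 / (N:ℝ) ≤ 1 / (N - (k + 1)) := by
      apply one_div_le_one_div_of_le
      · linarith
      · have : (0:ℝ) ≤ k := by positivity
        linarith
    have : 2 / (N:ℝ) = 1 / N + 1 / N := by ring
    linarith
  simp only [Finset.sum_sub_distrib, ← Finset.mul_sum] at hca hcb
  have hmain : β * (2 / (N:ℝ)) ≤ d * (N * (L + K) * d) := by
    have h1 := mul_le_mul_of_nonneg_left hs hβ.le
    have h2 : β * (∑ j, 1 / (x b - x j) - ∑ j, 1 / (x a - x j)) ≤ N * (L + K) * d := by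
      have := mul_le_mul_of_nonneg_left hq hNpos.le
      linarith
    have h3 := mul_le_mul_of_nonneg_left h2 hd0.le
    linarith
  have hdN : Real.sqrt (2 * β / (L + K + 1)) ≤ d * N := by
    apply Real.sqrt_le_iff.2
    refine ⟨by positivity, ?_⟩
    rw [div_le_iff₀ hKL]
    rw [mul_div_assoc', div_le_iff₀ hNpos] at hmain
    nlinarith [sq_nonneg (d * N)]
  rw [div_le_iff₀ hNpos]
  refine hdN.trans (mul_le_mul_of_nonneg_right ?_ hNpos.le)
  have hij' : (i:ℕ) + 1 ≤ j := hij
  have h1 := hgap' i j (by omega) j.isLt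
  rw [hXx, hXx] at h1
  have h2 : (1:ℝ) ≤ (j:ℕ) - (i:ℕ) := by
    have : (((i:ℕ) + 1 : ℕ) : ℝ) ≤ (j:ℕ) := by exact_mod_cast hij'
    push_cast at this
    linarith
  nlinarith

lemma En_prod (β : ℝ) (Q h : ℝ → ℝ) (N M : ℕ) (y : Fin N × Fin M → ℝ) :
    En β Q h y = (N : ℝ) * M * (∑ i, ∑ a, Q (y (i, a))) +
      1 / 2 * ∑ i, ∑ j, ∑ a, ∑ b, WW β h (y (i, a) - y (j, b)) := by
  unfold En
  rw [Fintype.card_prod, Fintype.card_fin, Fintype.card_fin, Fintype.sum_prod_type]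
  push_cast
  congr 2
  rw [Fintype.sum_prod_type]
  refine Finset.sum_congr rfl fun i _ => ?_
  simp only [Fintype.sum_prod_type]
  exact Finset.sum_comm

lemma log_le_abs (t : ℝ) : Real.log t ≤ |t| := by
  rw [← Real.log_abs]
  by_cases ht : |t| = 0
  · rw [ht]; simp
  · have := Real.log_le_sub_one_of_pos (lt_of_le_of_ne (abs_nonneg t) (Ne.symm ht))
    linarith

lemma En_block_lower {β : ℝ} {Q h : ℝ → ℝ} {α K H : ℝ} (P : Hyp β Q h α K H)
    (N M : ℕ) [NeZero M] (R : ℝ) (x : Fin N → ℝ) (hx : IsMinC β Q h x)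
    (y : Fin N × Fin M → ℝ) (hy : Function.Injective y) (hyR : ∀ p, |y p| ≤ R) :
    (M : ℝ) ^ 2 * En β Q h x ≤ En β Q h y + 1 / 2 * (N * (M : ℝ) ^ 2 * (2 * H + 2 * β * R)) := by
  have hM : (0 : ℝ) < M := by exact_mod_cast Nat.pos_of_ne_zero (NeZero.ne M)
  have hMN : (0 : ℝ) < (M : ℝ) ^ N := by positivity
  set D := 2 * H + 2 * β * R with hD
  have hW : ∀ p q, h 0 ≤ WW β h (y p - y q) + D := by
    intro p q
    unfold WW
    have h1 := log_le_abs (y p - y q)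
    have h2 := abs_sub (y p) (y q)
    have h3 := hyR p
    have h4 := hyR q
    have h5 : β * Real.log (y p - y q) ≤ β * (2 * R) :=
      mul_le_mul_of_nonneg_left (by linarith) P.hβ.le
    have h6 := abs_le.1 (P.hH 0)
    have h7 := abs_le.1 (P.hH (y p - y q))
    rw [hD]; linarith
  have h1 : ∀ a : Fin N → Fin M, En β Q h x ≤ En β Q h (fun i => y (i, a i)) := by
    intro a
    apply hx.2
    intro i j hij
    exact congrArg Prod.fst (hy hij)
  have h2 : (M : ℝ) ^ N * En β Q h x ≤ ∑ a : Fin N → Fin M, En β Q h (fun i => y (i, a i)) := by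
    have := Finset.sum_le_sum (fun a (_ : a ∈ (univ : Finset (Fin N → Fin M))) => h1 a)
    simpa using this
  have hQ : ∀ i : Fin N, (M : ℝ) * ∑ a : Fin N → Fin M, Q (y (i, a i)) =
      (M : ℝ) ^ N * ∑ b, Q (y (i, b)) := by
    intro i
    have := count_one M i (fun b => Q (y (i, b)))
    simpa using this
  have hWW : ∀ i j : Fin N, (M : ℝ) ^ 2 * ∑ a : Fin N → Fin M, WW β h (y (i, a i) - y (j, a j)) ≤
      (M : ℝ) ^ N * ((∑ b, ∑ c, WW β h (y (i, b) - y (j, c))) + if i = j then (M : ℝ) ^ 2 * D else 0) := by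
    intro i j
    by_cases hij : i = j
    · subst hij
      have e1 : ∑ a : Fin N → Fin M, WW β h (y (i, a i) - y (i, a i)) = (M : ℝ) ^ N * h 0 := by
        simp [WW]
      rw [e1, if_pos rfl]
      have e2 : (M : ℝ) ^ 2 * h 0 ≤ (∑ b, ∑ c, WW β h (y (i, b) - y (i, c))) + (M : ℝ) ^ 2 * D := by
        have : ∑ b : Fin M, ∑ c : Fin M, h 0 ≤
            ∑ b : Fin M, ∑ c : Fin M, (WW β h (y (i, b) - y (i, c)) + D) :=
          Finset.sum_le_sum fun b _ => Finset.sum_le_sum fun c _ => hW _ _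
        simp [Finset.sum_add_distrib] at this
        linarith
      nlinarith
    · have := count_two M i j hij (fun b c => WW β h (y (i, b) - y (j, c)))
      simp only [Fintype.card_fin] at this
      rw [this, if_neg hij, add_zero]
  have h3 : (M : ℝ) ^ 2 * ∑ a : Fin N → Fin M, En β Q h (fun i => y (i, a i)) ≤
      (M : ℝ) ^ N * (En β Q h y + 1 / 2 * (N * (M : ℝ) ^ 2 * D)) := by
    rw [En_prod]
    unfold En
    simp only [Fintype.card_fin]
    rw [Finset.sum_add_distrib, ← Finset.mul_sum, ← Finset.mul_sum, Finset.sum_comm]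
    have e : ∑ a : Fin N → Fin M, ∑ i, ∑ j, WW β h (y (i, a i) - y (j, a j)) =
        ∑ i, ∑ j, ∑ a : Fin N → Fin M, WW β h (y (i, a i) - y (j, a j)) := by
      rw [Finset.sum_comm]
      exact Finset.sum_congr rfl fun i _ => Finset.sum_comm
    rw [e]
    have e1 : (M : ℝ) * ∑ i, ∑ a : Fin N → Fin M, Q (y (i, a i)) =
        (M : ℝ) ^ N * ∑ i, ∑ b, Q (y (i, b)) := by
      rw [Finset.mul_sum, Finset.mul_sum]
      exact Finset.sum_congr rfl fun i _ => hQ i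
    have e2 : (M : ℝ) ^ 2 * ∑ i, ∑ j, ∑ a : Fin N → Fin M, WW β h (y (i, a i) - y (j, a j)) ≤
        (M : ℝ) ^ N * ((∑ i, ∑ j, ∑ b, ∑ c, WW β h (y (i, b) - y (j, c))) + N * ((M : ℝ) ^ 2 * D)) := by
      have e3 := Finset.sum_le_sum fun i (_ : i ∈ (univ : Finset (Fin N))) =>
        Finset.sum_le_sum fun j (_ : j ∈ (univ : Finset (Fin N))) => hWW i j
      simp only [← Finset.mul_sum, Finset.sum_add_distrib, Finset.sum_ite_eq, Finset.mem_univ,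
        if_true, Finset.sum_const, Finset.card_univ, Fintype.card_fin, nsmul_eq_mul] at e3
      rw [mul_left_comm (N : ℝ)]
      exact e3
    have e4 : (M : ℝ) ^ 2 * ((N : ℝ) * ∑ i, ∑ a : Fin N → Fin M, Q (y (i, a i))) =
        (M : ℝ) * N * ((M : ℝ) ^ N * ∑ i, ∑ b, Q (y (i, b))) := by
      rw [← e1]; ring
    rw [mul_add, e4]
    nlinarith
  have h4 : (M : ℝ) ^ N * ((M : ℝ) ^ 2 * En β Q h x) ≤
      (M : ℝ) ^ N * (En β Q h y + 1 / 2 * (N * (M : ℝ) ^ 2 * D)) := by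
    refine le_trans ?_ h3
    have := mul_le_mul_of_nonneg_left h2 (by positivity : (0:ℝ) ≤ (M:ℝ)^2)
    linarith
  exact le_of_mul_le_mul_left h4 hMN

lemma sum_log_le (M : ℕ) (hM : 0 < M) : ∑ k : Fin M, Real.log ((M : ℝ) / (k : ℕ)) ≤ M := by
  have hM' : (0 : ℝ) < M := by exact_mod_cast hM
  rw [Fin.sum_univ_eq_sum_range (fun k => Real.log ((M : ℝ) / (k : ℕ)))]
  have h1 := Finset.sum_range_succ (fun k : ℕ => Real.log ((M : ℝ) / (k : ℕ))) M
  have h2 := Finset.sum_range_succ' (fun k : ℕ => Real.log ((M : ℝ) / (k : ℕ))) M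
  rw [h1] at h2
  simp only [div_self hM'.ne', Real.log_one, add_zero, Nat.cast_zero, div_zero, Real.log_zero] at h2
  rw [h2, ← Real.log_prod (fun k _ => by positivity)]
  rw [Finset.prod_div_distrib]
  have : (∏ k ∈ range M, ((k + 1 : ℕ) : ℝ)) = (M.factorial : ℝ) := by
    rw [← Finset.prod_range_add_one_eq_factorial]
    push_cast; rfl
  rw [this, Finset.prod_const, card_range]
  rw [Real.log_le_iff_le_exp (by positivity)]
  exact Real.pow_div_factorial_le_exp _ hM'.le M

lemma sum_log_dist_le (M : ℕ) [NeZero M] (a : Fin M) :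
    ∑ b : Fin M, Real.log ((M : ℝ) / |((a : ℕ) : ℝ) - (b : ℕ)|) ≤ 2 * M := by
  have hM : 0 < M := Nat.pos_of_ne_zero (NeZero.ne M)
  have hM' : (0 : ℝ) < M := by exact_mod_cast hM
  have hnn : ∀ k : Fin M, 0 ≤ Real.log ((M : ℝ) / (k : ℕ)) := by
    intro k
    by_cases hk : (k : ℕ) = 0
    · simp [hk]
    · apply Real.log_nonneg
      have : (0 : ℝ) < (k : ℕ) := by exact_mod_cast Nat.pos_of_ne_zero hk
      rw [one_le_div this]
      exact_mod_cast k.isLt.le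
  have h1 : ∀ b : Fin M, Real.log ((M : ℝ) / |((a : ℕ) : ℝ) - (b : ℕ)|) ≤
      Real.log ((M : ℝ) / ((a - b : Fin M) : ℕ)) + Real.log ((M : ℝ) / ((b - a : Fin M) : ℕ)) := by
    intro b
    rcases le_total b a with hba | hba
    · have e : ((a - b : Fin M) : ℕ) = (a : ℕ) - b := Fin.coe_sub_iff_le.2 hba
      have e' : |((a : ℕ) : ℝ) - (b : ℕ)| = (((a - b : Fin M) : ℕ) : ℝ) := by
        rw [e, Nat.cast_sub hba, abs_of_nonneg]
        have : ((b : ℕ) : ℝ) ≤ (a : ℕ) := by exact_mod_cast hba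
        linarith
      rw [e']
      linarith [hnn (b - a)]
    · have e : ((b - a : Fin M) : ℕ) = (b : ℕ) - a := Fin.coe_sub_iff_le.2 hba
      have e' : |((a : ℕ) : ℝ) - (b : ℕ)| = (((b - a : Fin M) : ℕ) : ℝ) := by
        rw [e, Nat.cast_sub hba, abs_sub_comm, abs_of_nonneg]
        have : ((a : ℕ) : ℝ) ≤ (b : ℕ) := by exact_mod_cast hba
        linarith
      rw [e']
      linarith [hnn (a - b)]
  refine (Finset.sum_le_sum fun b _ => h1 b).trans ?_
  rw [Finset.sum_add_distrib]
  have e1 := Equiv.sum_comp (Equiv.subLeft a) (fun k : Fin M => Real.log ((M : ℝ) / (k : ℕ)))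
  have e2 := Equiv.sum_comp (Equiv.subRight a) (fun k : Fin M => Real.log ((M : ℝ) / (k : ℕ)))
  simp only [Equiv.subLeft_apply, Equiv.subRight_apply] at e1 e2
  rw [e1, e2]
  linarith [sum_log_le M hM]

/-- the refined comparison configuration -/
def zz {N M : ℕ} (x : Fin N → ℝ) (p : Fin N × Fin M) : ℝ :=
  x p.1 + ((finProdFinEquiv p : Fin (N * M)) : ℕ) / ((N : ℝ) * (N * M))

lemma theta_bd {N M : ℕ} (p : Fin N × Fin M) :
    0 ≤ (((finProdFinEquiv p : Fin (N * M)) : ℕ) : ℝ) / ((N : ℝ) * (N * M)) ∧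
    (((finProdFinEquiv p : Fin (N * M)) : ℕ) : ℝ) / ((N : ℝ) * (N * M)) ≤ 1 / N := by
  have hN : (0 : ℝ) < N := by exact_mod_cast p.1.pos
  have hM : (0 : ℝ) < M := by exact_mod_cast p.2.pos
  refine ⟨by positivity, ?_⟩
  rw [div_le_div_iff₀ (by positivity) hN]
  have : (((finProdFinEquiv p : Fin (N * M)) : ℕ) : ℝ) ≤ N * M := by
    exact_mod_cast (finProdFinEquiv p : Fin (N * M)).isLt.le
  nlinarith

lemma fst_le_of_lt {N M : ℕ} (p q : Fin N × Fin M)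
    (hpq : (finProdFinEquiv p : Fin (N * M)) < finProdFinEquiv q) : p.1 ≤ q.1 := by
  by_contra hc
  push Not at hc
  have h1 : (p.2 : ℕ) + M * p.1 < q.2 + M * q.1 := hpq
  have h2 : (q.1 : ℕ) + 1 ≤ p.1 := hc
  have h3 := q.2.isLt
  nlinarith [Nat.mul_le_mul_left M h2]

lemma lt_of_fst_lt {N M : ℕ} (p q : Fin N × Fin M) (hpq : p.1 < q.1) :
    (finProdFinEquiv p : Fin (N * M)) < finProdFinEquiv q := by
  change (p.2 : ℕ) + M * p.1 < q.2 + M * q.1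
  have h2 : (p.1 : ℕ) + 1 ≤ q.1 := hpq
  have h3 := p.2.isLt
  nlinarith [Nat.mul_le_mul_left M h2]

lemma zz_lt {N M : ℕ} (x : Fin N → ℝ) (hx : StrictMono x) (p q : Fin N × Fin M)
    (hpq : (finProdFinEquiv p : Fin (N * M)) < finProdFinEquiv q) : zz x p < zz x q := by
  have hN : (0 : ℝ) < N := by exact_mod_cast p.1.pos
  have hM : (0 : ℝ) < M := by exact_mod_cast p.2.pos
  unfold zz
  have h1 := hx.monotone (fst_le_of_lt p q hpq)
  have h2 : (((finProdFinEquiv p : Fin (N * M)) : ℕ) : ℝ) / ((N : ℝ) * (N * M)) <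
    (((finProdFinEquiv q : Fin (N * M)) : ℕ) : ℝ) / ((N : ℝ) * (N * M)) := by
    apply div_lt_div_of_pos_right _ (by positivity)
    exact_mod_cast hpq
  linarith

lemma En_zz_upper {β : ℝ} {Q h : ℝ → ℝ} {α K H : ℝ} (P : Hyp β Q h α K H)
    (N M : ℕ) [NeZero M] (hN : 0 < N) (R L : ℝ) (hL0 : 0 ≤ L)
    (hL : ∀ a b, |a| ≤ R + 1 → |b| ≤ R + 1 → |Q a - Q b| ≤ L * |a - b|)
    (x : Fin N → ℝ) (hx : StrictMono x) (hxR : ∀ i, |x i| ≤ R) :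
    En β Q h (zz (M := M) x) ≤ (M : ℝ) ^ 2 * En β Q h x +
      N * (M : ℝ) ^ 2 * (L + H + β * Real.log N + β) := by
  have hM : (0 : ℝ) < M := by exact_mod_cast Nat.pos_of_ne_zero (NeZero.ne M)
  have hN' : (0 : ℝ) < N := by exact_mod_cast hN
  have hN1 : 1 / (N : ℝ) ≤ 1 := by
    rw [div_le_one hN']; exact_mod_cast hN
  have hH : 0 ≤ H := (abs_nonneg _).trans (P.hH 0)
  rw [En_prod]
  unfold En
  simp only [Fintype.card_fin]
  have hQ : ∀ i (a : Fin M), Q (zz x (i, a)) ≤ Q (x i) + L / N := by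
    intro i a
    have ht := theta_bd (i, a)
    have h1 : |zz x (i, a) - x i| ≤ 1 / N := by
      unfold zz
      rw [add_sub_cancel_left, abs_of_nonneg ht.1]
      exact ht.2
    have h2 : |zz x (i, a)| ≤ R + 1 := by
      have := abs_add_le (zz x (i, a) - x i) (x i)
      rw [sub_add_cancel] at this
      linarith [hxR i]
    have h3 := hL _ _ h2 (by linarith [hxR i] : |x i| ≤ R + 1)
    have h4 := mul_le_mul_of_nonneg_left h1 hL0
    have h5 := (abs_le.1 h3).2
    have h6 : L * (1 / N) = L / N := by ring
    linarith
  have hh : ∀ (i j : Fin N) (a b : Fin M), h (zz x (i, a) - zz x (j, b)) ≤ h (x i - x j) + H / N := by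
    intro i j a b
    have h1 := P.hL (zz x (i, a) - zz x (j, b)) (x i - x j)
    have t1 := theta_bd (i, a)
    have t2 := theta_bd (j, b)
    have h2 : |zz x (i, a) - zz x (j, b) - (x i - x j)| ≤ 1 / N := by
      unfold zz
      rw [abs_le]
      constructor <;> simp only <;> linarith [t1.1, t1.2, t2.1, t2.2]
    have h4 := mul_le_mul_of_nonneg_left h2 hH
    have h5 := (abs_le.1 h1).2
    have h6 : H * (1 / N) = H / N := by ring
    linarith
  have hW : ∀ i j : Fin N, ∑ a : Fin M, ∑ b : Fin M, WW β h (zz x (i, a) - zz x (j, b)) ≤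
      (M : ℝ) ^ 2 * (WW β h (x i - x j) + H / N + if i = j then (2 * β * Real.log N + 2 * β) else 0) := by
    intro i j
    by_cases hij : i = j
    · subst hij
      rw [if_pos rfl]
      have key : ∀ a b : Fin M, WW β h (zz x (i, a) - zz x (i, b)) ≤
          h 0 + H / N + 2 * β * Real.log N + β * Real.log ((M : ℝ) / |((a : ℕ) : ℝ) - (b : ℕ)|) := by
        intro a b
        unfold WW
        have h1 := hh i i a b
        rw [sub_self] at h1
        have hlN : 0 ≤ Real.log N := Real.log_nonneg (by exact_mod_cast hN)
        have h2 : - Real.log (zz x (i, a) - zz x (i, b)) ≤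
            2 * Real.log N + Real.log ((M : ℝ) / |((a : ℕ) : ℝ) - (b : ℕ)|) := by
          by_cases hab : a = b
          · subst hab
            simp; exact hlN
          · have hne : |((a : ℕ) : ℝ) - (b : ℕ)| ≠ 0 := by
              rw [abs_ne_zero, sub_ne_zero]
              exact_mod_cast fun hc => hab (Fin.ext hc)
            have e : zz x (i, a) - zz x (i, b) = (((a : ℕ) : ℝ) - (b : ℕ)) / (N * N * M) := by
              unfold zz
              simp only [finProdFinEquiv_apply_val]
              push_cast
              field_simp
              ring
            rw [← Real.log_abs, e, abs_div, Real.log_div hne (by positivity),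
              Real.log_div hM.ne' hne, abs_of_pos (by positivity : (0:ℝ) < N * N * M),
              Real.log_mul (by positivity) (by positivity), Real.log_mul hN'.ne' hN'.ne']
            linarith
        have := mul_le_mul_of_nonneg_left h2 P.hβ.le
        linarith
      refine (Finset.sum_le_sum fun a _ => Finset.sum_le_sum fun b _ => key a b).trans ?_
      have h3 : ∀ a : Fin M, ∑ b : Fin M, (h 0 + H / N + 2 * β * Real.log N +
          β * Real.log ((M : ℝ) / |((a : ℕ) : ℝ) - (b : ℕ)|)) ≤
          M * (h 0 + H / N + 2 * β * Real.log N) + β * (2 * M) := by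
        intro a
        rw [Finset.sum_add_distrib, ← Finset.mul_sum]
        have := mul_le_mul_of_nonneg_left (sum_log_dist_le M a) P.hβ.le
        simp only [Finset.sum_const, Finset.card_univ, Fintype.card_fin, nsmul_eq_mul]
        linarith
      refine (Finset.sum_le_sum fun a _ => h3 a).trans ?_
      simp only [Finset.sum_const, Finset.card_univ, Fintype.card_fin, nsmul_eq_mul, sub_self, WW,
        Real.log_zero]
      apply le_of_eq; ring
    · rw [if_neg hij, add_zero]
      have key : ∀ a b : Fin M, WW β h (zz x (i, a) - zz x (j, b)) ≤ WW β h (x i - x j) + H / N := by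
        intro a b
        unfold WW
        have h1 := hh i j a b
        have hlog : Real.log (x i - x j) ≤ Real.log (zz x (i, a) - zz x (j, b)) := by
          rw [← Real.log_abs, ← Real.log_abs (zz x (i, a) - _)]
          have hne : x i - x j ≠ 0 := sub_ne_zero.2 fun hc => hij (hx.injective hc)
          apply Real.log_le_log (abs_pos.2 hne)
          rcases lt_or_gt_of_ne hij with hlt | hlt
          · have h2 := lt_of_fst_lt (i, a) (j, b) hlt
            have h3 : (((finProdFinEquiv (i, a) : Fin (N * M)) : ℕ) : ℝ) / ((N : ℝ) * (N * M)) <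
              (((finProdFinEquiv (j, b) : Fin (N * M)) : ℕ) : ℝ) / ((N : ℝ) * (N * M)) := by
              apply div_lt_div_of_pos_right _ (by positivity)
              exact_mod_cast h2
            have h4 := hx hlt
            have h5 := zz_lt x hx _ _ h2
            rw [abs_of_neg (by linarith), abs_of_neg (by linarith)]
            unfold zz
            simp only
            linarith
          · have h2 := lt_of_fst_lt (j, b) (i, a) hlt
            have h3 : (((finProdFinEquiv (j, b) : Fin (N * M)) : ℕ) : ℝ) / ((N : ℝ) * (N * M)) <
              (((finProdFinEquiv (i, a) : Fin (N * M)) : ℕ) : ℝ) / ((N : ℝ) * (N * M)) := by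
              apply div_lt_div_of_pos_right _ (by positivity)
              exact_mod_cast h2
            have h4 := hx hlt
            have h5 := zz_lt x hx _ _ h2
            rw [abs_of_pos (by linarith), abs_of_pos (by linarith)]
            unfold zz
            simp only
            linarith
        have := mul_le_mul_of_nonneg_left hlog P.hβ.le
        linarith
      refine (Finset.sum_le_sum fun a _ => Finset.sum_le_sum fun b _ => key a b).trans ?_
      simp only [Finset.sum_const, Finset.card_univ, Fintype.card_fin, nsmul_eq_mul]
      apply le_of_eq; ring
  have h1 : ∑ i, ∑ a : Fin M, Q (zz x (i, a)) ≤ M * ∑ i, Q (x i) + M * L := by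
    refine (Finset.sum_le_sum fun i _ => Finset.sum_le_sum fun a _ => hQ i a).trans ?_
    simp only [Finset.sum_const, Finset.card_univ, Fintype.card_fin, nsmul_eq_mul, ← Finset.mul_sum,
      Finset.sum_add_distrib]
    apply le_of_eq; field_simp
  have h2 : ∑ i, ∑ j, ∑ a : Fin M, ∑ b : Fin M, WW β h (zz x (i, a) - zz x (j, b)) ≤
      (M : ℝ) ^ 2 * ((∑ i, ∑ j, WW β h (x i - x j)) + N * H + N * (2 * β * Real.log N + 2 * β)) := by
    refine (Finset.sum_le_sum fun i _ => Finset.sum_le_sum fun j _ => hW i j).trans ?_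
    simp only [Finset.sum_const, Finset.card_univ, Fintype.card_fin, nsmul_eq_mul, ← Finset.mul_sum,
      Finset.sum_add_distrib, Finset.sum_ite_eq, Finset.mem_univ, if_true]
    apply le_of_eq; field_simp
  have h3 := mul_le_mul_of_nonneg_left h1 (by positivity : (0:ℝ) ≤ N * M)
  have h4 : 0 ≤ (N : ℝ) * (M : ℝ) ^ 2 * H := by positivity
  nlinarith

lemma refine_close {β : ℝ} {Q h : ℝ → ℝ} {α K H : ℝ} (P : Hyp β Q h α K H) :
    ∃ η : ℕ → ℝ, Tendsto η atTop (𝓝 0) ∧ ∀ (N M : ℕ), 0 < N → 0 < M →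
      ∀ (x : Fin N → ℝ) (w : Fin (N * M) → ℝ), IsMinC β Q h x → IsMinC β Q h w →
      ∑ i, ∑ a : Fin M, |x i - w (finProdFinEquiv (i, a))| ≤ N * M * η N := by
  obtain ⟨R, hR, hb⟩ := min_bounded P
  obtain ⟨L, hL0, hL⟩ := P.Qd (R + 1)
  have hc : 0 < α - K := by linarith [P.hαK]
  set c1 := L + H + β + (H + β * R) with hc1
  refine ⟨fun N => Real.sqrt (4 / (α - K) * (c1 / N + β * (Real.log N / N))) + 1 / N, ?_, ?_⟩
  · have t1 : Tendsto (fun N : ℕ => c1 / (N : ℝ)) atTop (𝓝 0) := tendsto_const_div_atTop_nhds_zero_nat c1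
    have t2 : Tendsto (fun N : ℕ => Real.log N / (N : ℝ)) atTop (𝓝 0) := by
      have := (Real.isLittleO_log_id_atTop.tendsto_div_nhds_zero).comp tendsto_natCast_atTop_atTop
      exact this
    have t3 : Tendsto (fun N : ℕ => 1 / (N : ℝ)) atTop (𝓝 0) := tendsto_const_div_atTop_nhds_zero_nat 1
    have t4 := ((((t1.add (t2.const_mul β)).const_mul (4 / (α - K))).sqrt).add t3)
    simpa using t4
  · intro N M hN hM x w hx hw
    have : NeZero M := ⟨hM.ne'⟩
    have hN' : (0 : ℝ) < N := by exact_mod_cast hN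
    have hM' : (0 : ℝ) < M := by exact_mod_cast hM
    set y : Fin N × Fin M → ℝ := fun p => w (finProdFinEquiv p) with hy
    have hyinj : Function.Injective y := hw.1.injective.comp finProdFinEquiv.injective
    have l1 := En_block_lower P N M R x hx y hyinj (fun p => hb _ w hw _)
    have l2 := En_zz_upper P N M hN R L hL0 (fun a b ha hb => (hL a b ha hb).2) x hx.1 (hb _ x hx)
    have hord : ∀ p q : Fin N × Fin M, p ≠ q → 0 < (y p - y q) * (zz x p - zz x q) := by
      intro p q hpq
      have : (finProdFinEquiv p : Fin (N * M)) ≠ finProdFinEquiv q := fun hc => hpq (finProdFinEquiv.injective hc)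
      rcases lt_or_gt_of_ne this with hlt | hlt
      · have a1 := hw.1 hlt
        have a2 := zz_lt x hx.1 _ _ hlt
        exact mul_pos_of_neg_of_neg (sub_neg.2 a1) (sub_neg.2 a2)
      · have a1 := hw.1 hlt
        have a2 := zz_lt x hx.1 _ _ hlt
        exact mul_pos (sub_pos.2 a1) (sub_pos.2 a2)
    have hmin : ∀ z : Fin N × Fin M → ℝ, Function.Injective z → En β Q h y ≤ En β Q h z := by
      intro z hz
      have e1 := En_comp β Q h (finProdFinEquiv : Fin N × Fin M ≃ Fin (N * M)) w
      have e2 := En_comp β Q h (finProdFinEquiv : Fin N × Fin M ≃ Fin (N * M)).symm z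
      rw [hy, e1, ← e2]
      exact hw.2 _ (hz.comp (Equiv.injective _))
    have l3 := (En_strong P y (zz x) hord hmin).1
    rw [Fintype.card_prod, Fintype.card_fin, Fintype.card_fin] at l3
    push_cast at l3
    set S := ∑ p : Fin N × Fin M, (y p - zz x p) ^ 2 with hS
    have l4 : (N : ℝ) * M * (α - K) / 4 * S ≤ N * (M : ℝ) ^ 2 * (c1 + β * Real.log N) := by
      rw [hc1]; nlinarith
    have l5 : S ≤ N * M * (4 / (α - K) * (c1 / N + β * (Real.log N / N))) := by
      have e : N * (M : ℝ) ^ 2 * (c1 + β * Real.log N) =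
        ((N : ℝ) * M * (α - K) / 4) * (N * M * (4 / (α - K) * (c1 / N + β * (Real.log N / N)))) := by
        field_simp
      rw [e] at l4
      exact le_of_mul_le_mul_left l4 (by positivity)
    set B := 4 / (α - K) * (c1 / N + β * (Real.log N / N)) with hB
    have l6 : (∑ p : Fin N × Fin M, |y p - zz x p|) ≤ N * M * Real.sqrt B := by
      have cs := sq_sum_le_card_mul_sum_sq (s := (univ : Finset (Fin N × Fin M)))
        (f := fun p => |y p - zz x p|)
      simp only [sq_abs, Finset.card_univ, Fintype.card_prod, Fintype.card_fin] at cs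
      push_cast at cs
      have hB0 : 0 ≤ B := by
        have : 0 ≤ S := Finset.sum_nonneg fun _ _ => sq_nonneg _
        exact nonneg_of_mul_nonneg_right (this.trans l5) (by positivity)
      have h1 : (∑ p : Fin N × Fin M, |y p - zz x p|) ^ 2 ≤ (N * M * Real.sqrt B) ^ 2 := by
        rw [mul_pow, Real.sq_sqrt hB0]
        refine cs.trans ?_
        have := mul_le_mul_of_nonneg_left l5 (by positivity : (0:ℝ) ≤ N * M)
        nlinarith
      exact (sq_le_sq₀ (Finset.sum_nonneg fun _ _ => abs_nonneg _) (by positivity)).1 h1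
    rw [← Fintype.sum_prod_type (fun p : Fin N × Fin M => |x p.1 - w (finProdFinEquiv p)|)]
    have l7 : ∀ p : Fin N × Fin M, |x p.1 - w (finProdFinEquiv p)| ≤ |y p - zz x p| + 1 / N := by
      intro p
      have t := theta_bd p
      have e : x p.1 - w (finProdFinEquiv p) = -(y p - zz x p) + -(zz x p - x p.1) := by
        rw [hy]; ring
      rw [e]
      refine (abs_add_le _ _).trans ?_
      rw [abs_neg, abs_neg]
      have : |zz x p - x p.1| ≤ 1 / N := by
        unfold zz
        rw [add_sub_cancel_left, abs_of_nonneg t.1]; exact t.2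
      linarith
    refine (Finset.sum_le_sum fun p _ => l7 p).trans ?_
    rw [Finset.sum_add_distrib]
    simp only [Finset.sum_const, Finset.card_univ, Fintype.card_prod, Fintype.card_fin, nsmul_eq_mul]
    push_cast
    linarith

/-- empirical measure -/
def emp {N : ℕ} (x : Fin N → ℝ) : Measure ℝ := (N : ENNReal)⁻¹ • ∑ i, Measure.dirac (x i)

lemma emp_prob {N : ℕ} (hN : 0 < N) (x : Fin N → ℝ) : IsProbabilityMeasure (emp x) := by
  constructor
  unfold emp
  simp
  exact ENNReal.inv_mul_cancel (by exact_mod_cast hN.ne') (ENNReal.natCast_ne_top N)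

/-- empirical measure as a probability measure -/
def empP {N : ℕ} (x : Fin (N + 1) → ℝ) : ProbabilityMeasure ℝ := ⟨emp x, emp_prob N.succ_pos x⟩

lemma emp_integral {N : ℕ} (x : Fin N → ℝ) (f : ℝ → ℝ) :
    ∫ t, f t ∂(emp x) = (N : ℝ)⁻¹ * ∑ i, f (x i) := by
  unfold emp
  rw [integral_smul_measure, integral_finsetSum_measure]
  · simp
  · intro i _
    exact integrable_dirac (by simp)

lemma emp_pi {N : ℕ} (hN : 0 < N) (x : Fin N → ℝ) (k : ℕ) :
    Measure.pi (fun _ : Fin k => emp x) =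
      ((N : ENNReal)⁻¹) ^ k • ∑ τ : Fin k → Fin N, Measure.dirac (fun i => x (τ i)) := by
  have := emp_prob hN x
  refine Measure.pi_eq fun s hs => ?_
  have h1 : ∀ i, emp x (s i) = (N : ENNReal)⁻¹ * ∑ j, (s i).indicator 1 (x j) := by
    intro i
    unfold emp
    simp [Measure.dirac_apply' _ (hs i)]
  simp only [h1]
  rw [Finset.prod_mul_distrib, Finset.prod_univ_sum]
  simp only [Measure.smul_apply, Measure.finsetSum_apply, smul_eq_mul, Fintype.piFinset_univ,
    Finset.prod_const, Finset.card_univ, Fintype.card_fin]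
  congr 1
  refine Finset.sum_congr rfl fun τ _ => ?_
  rw [Measure.dirac_apply' _ (MeasurableSet.univ_pi hs)]
  by_cases hm : (fun i => x (τ i)) ∈ Set.univ.pi s
  · rw [Set.indicator_of_mem hm]
    simp only [Set.mem_univ_pi] at hm
    symm
    exact Finset.prod_eq_one fun i _ => by rw [Set.indicator_of_mem (hm i)]; rfl
  · rw [Set.indicator_of_notMem hm]
    simp only [Set.mem_univ_pi, not_forall] at hm
    obtain ⟨i, hi⟩ := hm
    symm
    exact Finset.prod_eq_zero (Finset.mem_univ i) (Set.indicator_of_notMem hi _)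

lemma emp_pi_integral {N : ℕ} (hN : 0 < N) (x : Fin N → ℝ) (k : ℕ) (F : (Fin k → ℝ) → ℝ) :
    ∫ t, F t ∂(Measure.pi (fun _ : Fin k => emp x)) =
      ((N : ℝ) ^ k)⁻¹ * ∑ τ : Fin k → Fin N, F (fun i => x (τ i)) := by
  rw [emp_pi hN, integral_smul_measure, integral_finsetSum_measure]
  · simp
  · intro i _
    exact integrable_dirac (by simp)

lemma limit_exists (L : ℕ → ProbabilityMeasure ℝ) (R : ℝ)
    (hR : ∀ n, (L n : Measure ℝ) (Metric.closedBall 0 R)ᶜ = 0)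
    (hC : ∀ f : ℝ → ℝ, (∃ K, LipschitzWith K f) → CauchySeq (fun n => ∫ t, f t ∂(L n : Measure ℝ))) :
    ∃ μ : ProbabilityMeasure ℝ, Tendsto L atTop (𝓝 μ) := by
  have htight : IsTightMeasureSet {((μ : ProbabilityMeasure ℝ) : Measure ℝ) | μ ∈ Set.range L} := by
    rw [isTightMeasureSet_iff_exists_isCompact_measure_compl_le]
    intro ε _
    refine ⟨Metric.closedBall 0 R, isCompact_closedBall _ _, ?_⟩
    rintro _ ⟨_, ⟨n, rfl⟩, rfl⟩
    rw [hR n]; exact zero_le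
  have hc := isCompact_closure_of_isTightMeasureSet htight
  obtain ⟨μ, -, hμ⟩ := hc.exists_mapClusterPt (f := atTop) (u := L)
    (tendsto_principal.2 (Eventually.of_forall fun n => subset_closure ⟨n, rfl⟩))
  refine ⟨μ, ?_⟩
  rw [tendsto_iff_forall_lipschitz_integral_tendsto]
  intro f hfb hfl
  have hcau := hC f hfl
  let f' : BoundedContinuousFunction ℝ ℝ :=
    { toFun := f
      continuous_toFun := hfl.choose_spec.continuous
      map_bounded' := hfb }
  have hcont : Continuous (fun ν : ProbabilityMeasure ℝ => ∫ t, f t ∂(ν : Measure ℝ)) :=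
    ProbabilityMeasure.continuous_integral_boundedContinuousFunction f'
  have hcl : MapClusterPt (∫ t, f t ∂(μ : Measure ℝ)) atTop (fun n => ∫ t, f t ∂(L n : Measure ℝ)) :=
    hμ.continuousAt_comp hcont.continuousAt
  exact le_nhds_of_cauchy_adhp hcau hcl

lemma emp_le_volume {N : ℕ} (hN : 0 < N) (C : ℝ) (hC : 0 < C) (x : Fin N → ℝ)
    (hx : ∀ i j, i < j → C / N ≤ x j - x i) (A : Set ℝ) (δ : ℝ) (hδ : C / N ≤ δ) :
    emp x (Metric.thickening δ A) ≤ (ENNReal.ofReal C)⁻¹ * volume (Metric.thickening (δ + δ) A) := by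
  classical
  have hN' : (0 : ℝ) < N := by exact_mod_cast hN
  have hmeas : MeasurableSet (Metric.thickening δ A) := Metric.isOpen_thickening.measurableSet
  set S : Finset (Fin N) := univ.filter fun i => x i ∈ Metric.thickening δ A with hS
  have h1 : emp x (Metric.thickening δ A) = (N : ENNReal)⁻¹ * (S.card : ENNReal) := by
    unfold emp
    simp only [Measure.smul_apply, Measure.finsetSum_apply, smul_eq_mul,
      Measure.dirac_apply' _ hmeas]
    congr 1
    rw [hS, Finset.card_filter]
    push_cast
    refine Finset.sum_congr rfl fun i _ => ?_
    simp [Set.indicator_apply]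
  have hdisj : Set.PairwiseDisjoint (S : Set (Fin N)) (fun i => Set.Ioo (x i) (x i + C / N)) := by
    intro i _ j _ hij
    refine Set.disjoint_left.2 fun t ht ht' => ?_
    rcases lt_or_gt_of_ne hij with hlt | hlt
    · have := hx i j hlt
      linarith [ht.2, ht'.1]
    · have := hx j i hlt
      linarith [ht.1, ht'.2]
  have hsub : (⋃ i ∈ S, Set.Ioo (x i) (x i + C / N)) ⊆ Metric.thickening (δ + δ) A := by
    intro t ht
    simp only [Set.mem_iUnion] at ht
    obtain ⟨i, hi, hti⟩ := ht
    rw [hS, Finset.mem_filter] at hi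
    obtain ⟨a, ha, hda⟩ := Metric.mem_thickening_iff.1 hi.2
    refine Metric.mem_thickening_iff.2 ⟨a, ha, ?_⟩
    have h2 : dist t (x i) < δ := by
      rw [Real.dist_eq, abs_of_pos (by linarith [hti.1])]
      linarith [hti.2]
    linarith [dist_triangle t (x i) a]
  have h2 : (S.card : ENNReal) * ENNReal.ofReal (C / N) ≤ volume (Metric.thickening (δ + δ) A) := by
    refine le_trans (le_of_eq ?_) (measure_mono hsub)
    rw [measure_biUnion_finset hdisj (fun i _ => measurableSet_Ioo)]
    simp [Real.volume_Ioo]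
  rw [h1]
  have h3 : (N : ENNReal)⁻¹ * (S.card : ENNReal) =
      (ENNReal.ofReal C)⁻¹ * ((S.card : ENNReal) * ENNReal.ofReal (C / N)) := by
    have hC0 : ENNReal.ofReal C ≠ 0 := by simpa using hC
    rw [ENNReal.ofReal_div_of_pos hN', ENNReal.ofReal_natCast, div_eq_mul_inv]
    calc (N : ENNReal)⁻¹ * (S.card : ENNReal)
        = ((ENNReal.ofReal C)⁻¹ * ENNReal.ofReal C) * ((N : ENNReal)⁻¹ * (S.card : ENNReal)) := by
          rw [ENNReal.inv_mul_cancel hC0 ENNReal.ofReal_ne_top, one_mul]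
      _ = _ := by ring
  rw [h3]
  gcongr

lemma ac_of_thick (μ : ProbabilityMeasure ℝ) (L : ℕ → ProbabilityMeasure ℝ)
    (hL : Tendsto L atTop (𝓝 μ)) (c : ENNReal) (hc : c ≠ ⊤)
    (hb : ∀ (A : Set ℝ) (δ : ℝ), 0 < δ → ∀ᶠ n in atTop,
      (L n : Measure ℝ) (Metric.thickening δ A) ≤ c * volume (Metric.thickening (δ + δ) A)) :
    (μ : Measure ℝ) ≪ volume := by
  have hcomp : ∀ A : Set ℝ, IsCompact A → (μ : Measure ℝ) A ≤ c * volume A := by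
    intro A hA
    have h1 : ∀ δ : ℝ, 0 < δ → (μ : Measure ℝ) A ≤ c * volume (Metric.cthickening (δ + δ) A) := by
      intro δ hδ
      have h2 := ProbabilityMeasure.le_liminf_measure_open_of_tendsto hL
        (Metric.isOpen_thickening (δ := δ) (E := A))
      refine (measure_mono (Metric.self_subset_thickening hδ A)).trans (h2.trans ?_)
      refine (liminf_le_of_frequently_le' (Eventually.frequently (hb A δ hδ))).trans ?_
      gcongr
      exact Metric.thickening_subset_cthickening _ _
    have h3 : Tendsto (fun δ : ℝ => c * volume (Metric.cthickening (δ + δ) A)) (𝓝[>] 0)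
        (𝓝 (c * volume A)) := by
      refine ENNReal.Tendsto.const_mul ?_ (Or.inr hc)
      have h4 := tendsto_measure_cthickening_of_isCompact (μ := (volume : Measure ℝ)) hA
      refine h4.comp ?_
      have : Tendsto (fun δ : ℝ => δ + δ) (𝓝 0) (𝓝 (0 + 0)) :=
        (continuous_id.add continuous_id).tendsto 0
      rw [add_zero] at this
      exact this.mono_left nhdsWithin_le_nhds
    exact ge_of_tendsto h3 (by filter_upwards [self_mem_nhdsWithin] with δ hδ using h1 δ hδ)
  refine Measure.AbsolutelyContinuous.mk fun s hs h0 => ?_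
  rw [hs.measure_eq_iSup_isCompact]
  simp only [ENNReal.iSup_eq_zero]
  intro A hAs hA
  have := hcomp A hA
  rw [measure_mono_null hAs h0, mul_zero] at this
  exact le_antisymm this zero_le

lemma pi_density (μ : Measure ℝ) [IsProbabilityMeasure μ] (g : ℝ → ℝ) (hg0 : ∀ t, 0 ≤ g t)
    (hgi : Integrable g) (hμ : μ = volume.withDensity (fun t => ENNReal.ofReal (g t))) (k : ℕ) :
    Measure.pi (fun _ : Fin k => μ) =
      volume.withDensity (fun t : Fin k → ℝ => ENNReal.ofReal (∏ i, g (t i))) := by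
  refine Measure.pi_eq fun s hs => ?_
  rw [withDensity_apply _ (MeasurableSet.univ_pi hs), ← lintegral_indicator (MeasurableSet.univ_pi hs)]
  have e1 : ∀ t : Fin k → ℝ, (Set.univ.pi s).indicator
      (fun t : Fin k → ℝ => ENNReal.ofReal (∏ i, g (t i))) t =
      ENNReal.ofReal (∏ i, (s i).indicator g (t i)) := by
    intro t
    by_cases hm : t ∈ Set.univ.pi s
    · rw [Set.indicator_of_mem hm]
      simp only [Set.mem_univ_pi] at hm
      congr 1
      exact Finset.prod_congr rfl fun i _ => by rw [Set.indicator_of_mem (hm i)]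
    · rw [Set.indicator_of_notMem hm]
      simp only [Set.mem_univ_pi, not_forall] at hm
      obtain ⟨i, hi⟩ := hm
      rw [Finset.prod_eq_zero (Finset.mem_univ i) (Set.indicator_of_notMem hi _), ENNReal.ofReal_zero]
  simp only [e1]
  have hIntg : ∀ i, Integrable ((s i).indicator g) := fun i => hgi.indicator (hs i)
  have hnn : ∀ i t, 0 ≤ (s i).indicator g t := fun i t => Set.indicator_nonneg (fun t _ => hg0 t) t
  have hpi : Integrable (fun t : Fin k → ℝ => ∏ i, (s i).indicator g (t i)) :=
    Integrable.fintype_prod (f := fun i => (s i).indicator g) hIntg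
  rw [← ofReal_integral_eq_lintegral_ofReal hpi
    (Eventually.of_forall fun t => Finset.prod_nonneg fun i _ => hnn i _)]
  rw [integral_fintype_prod_volume_eq_prod (f := fun i => (s i).indicator g)]
  rw [ENNReal.ofReal_prod_of_nonneg (fun i _ => integral_nonneg (hnn i))]
  refine Finset.prod_congr rfl fun i _ => ?_
  rw [integral_indicator (hs i), hμ, withDensity_apply _ (hs i),
    ofReal_integral_eq_lintegral_ofReal hgi.integrableOn (Eventually.of_forall hg0)]

lemma limit_measure {β : ℝ} {Q h : ℝ → ℝ} {α K H : ℝ} (P : Hyp β Q h α K H)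
    (x : ∀ N : ℕ, Fin (N + 1) → ℝ) (hx : ∀ N, IsMinC β Q h (x N)) :
    ∃ μ : ProbabilityMeasure ℝ, (μ : Measure ℝ) ≪ volume ∧
      Tendsto (fun N => empP (x N)) atTop (𝓝 μ) := by
  obtain ⟨R, hR, hb⟩ := min_bounded P
  obtain ⟨C, hC, hgap⟩ := min_gap P
  obtain ⟨η, hη, hclose⟩ := refine_close P
  set L : ℕ → ProbabilityMeasure ℝ := fun N => empP (x N) with hL
  have hone : ∀ (f : ℝ → ℝ) (Kf : NNReal), LipschitzWith Kf f → ∀ (N M : ℕ),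
      |∫ t, f t ∂(emp (x N)) - ∫ t, f t ∂(emp (x ((N + 1) * (M + 1) - 1)))| ≤ Kf * η (N + 1) := by
    intro f Kf hf N M
    have hpos : (N + 1) * (M + 1) - 1 + 1 = (N + 1) * (M + 1) := Nat.sub_add_cancel (Nat.succ_le_of_lt (by positivity))
    obtain ⟨w, hw, hwe⟩ : ∃ w : Fin ((N + 1) * (M + 1)) → ℝ, IsMinC β Q h w ∧
        ∫ t, f t ∂(emp w) = ∫ t, f t ∂(emp (x ((N + 1) * (M + 1) - 1))) := by
      have hg := hx ((N + 1) * (M + 1) - 1)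
      generalize x ((N + 1) * (M + 1) - 1) = v at hg ⊢
      revert v
      rw [hpos]
      intro v hv
      exact ⟨v, hv, rfl⟩
    rw [← hwe, emp_integral, emp_integral]
    have hc := hclose (N + 1) (M + 1) N.succ_pos M.succ_pos (x N) w (hx N) hw
    have hN' : (0 : ℝ) < ((N + 1 : ℕ) : ℝ) := by positivity
    have hM' : (0 : ℝ) < ((M + 1 : ℕ) : ℝ) := by positivity
    have e1 : (((N + 1 : ℕ) : ℝ))⁻¹ * ∑ i, f (x N i) =
        (((N + 1 : ℕ) : ℝ) * ((M + 1 : ℕ) : ℝ))⁻¹ * ∑ i, ∑ a : Fin (M + 1), f (x N i) := by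
      simp only [Finset.sum_const, Finset.card_univ, Fintype.card_fin, nsmul_eq_mul, ← Finset.mul_sum]
      field_simp
    have e2 : ∑ i, f (w i) = ∑ i, ∑ a : Fin (M + 1), f (w (finProdFinEquiv (i, a))) := by
      rw [← Equiv.sum_comp finProdFinEquiv, Fintype.sum_prod_type]
    rw [e1, e2, Nat.cast_mul, ← mul_sub, ← Finset.sum_sub_distrib, abs_mul, abs_of_pos (by positivity)]
    rw [inv_mul_le_iff₀ (by positivity)]
    refine (Finset.abs_sum_le_sum_abs _ _).trans ?_
    refine le_trans (Finset.sum_le_sum (g := fun i => ∑ a : Fin (M + 1), Kf * |x N i - w (finProdFinEquiv (i, a))|) fun i _ => ?_) ?_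
    · rw [← Finset.sum_sub_distrib]
      refine (Finset.abs_sum_le_sum_abs _ _).trans (Finset.sum_le_sum fun a _ => ?_)
      have := hf.dist_le_mul (x N i) (w (finProdFinEquiv (i, a)))
      rwa [Real.dist_eq, Real.dist_eq] at this
    · simp only [← Finset.mul_sum]
      have := mul_le_mul_of_nonneg_left hc Kf.coe_nonneg
      refine this.trans (le_of_eq ?_)
      ring
  have hCau : ∀ f : ℝ → ℝ, (∃ K, LipschitzWith K f) →
      CauchySeq (fun n => ∫ t, f t ∂(L n : Measure ℝ)) := by
    rintro f ⟨Kf, hf⟩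
    have hη' : Tendsto (fun N => Kf * η (N + 1)) atTop (𝓝 0) := by
      have := ((tendsto_add_atTop_iff_nat 1).2 hη).const_mul (Kf : ℝ)
      simpa using this
    rw [Metric.cauchySeq_iff]
    intro ε hε
    obtain ⟨n0, hn0⟩ := eventually_atTop.1 (hη'.eventually (gt_mem_nhds (half_pos hε)))
    refine ⟨n0, fun m hm n hn => ?_⟩
    have h1 := hone f Kf hf m n
    have h2 := hone f Kf hf n m
    rw [mul_comm (n + 1)] at h2
    have h3 := hn0 m hm
    have h4 := hn0 n hn
    rw [Real.dist_eq]
    change |∫ t, f t ∂(emp (x m)) - ∫ t, f t ∂(emp (x n))| < ε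
    rw [abs_le] at h1 h2
    rw [abs_lt]
    constructor <;> linarith [h1.1, h1.2, h2.1, h2.2]
  obtain ⟨μ, hμ⟩ := limit_exists L R (fun n => by
    change emp (x n) _ = 0
    unfold emp
    simp only [Measure.smul_apply, Measure.finsetSum_apply, smul_eq_mul,
      Measure.dirac_apply' _ Metric.isClosed_closedBall.measurableSet.compl]
    rw [Finset.sum_eq_zero, mul_zero]
    intro i _
    apply Set.indicator_of_notMem
    simp only [Set.mem_compl_iff, not_not, mem_closedBall_zero_iff]
    exact hb _ _ (hx n) i) hCau
  refine ⟨μ, ?_, hμ⟩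
  refine ac_of_thick μ L hμ (ENNReal.ofReal C)⁻¹ (ENNReal.inv_ne_top.2 (by simpa using hC)) ?_
  intro A δ hδ
  have ht : Tendsto (fun n : ℕ => C / ((n + 1 : ℕ) : ℝ)) atTop (𝓝 0) :=
    (tendsto_add_atTop_iff_nat (f := fun n : ℕ => C / (n : ℝ)) 1).2 (tendsto_const_div_atTop_nhds_zero_nat C)
  filter_upwards [ht.eventually (gt_mem_nhds hδ)] with n hn
  exact emp_le_volume n.succ_pos C hC (x n) (hgap _ _ (hx n)) A δ hn.le

lemma weight_perm {β : ℝ} {Q h : ℝ → ℝ} {α K H : ℝ} (P : Hyp β Q h α K H) {N : ℕ}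
    (σ : Equiv.Perm (Fin N)) (x : Fin N → ℝ) :
    weightH β Q h N (fun i => x (σ i)) = weightH β Q h N x := by
  by_cases hx : Function.Injective x
  · rw [weight_inj P x hx, weight_inj P (fun i => x (σ i)) (hx.comp σ.injective), En_comp]
  · rw [weight_noninj P.hβ Q h x hx, weight_noninj P.hβ Q h]
    intro hc
    apply hx
    have := hc.comp σ.symm.injective
    have e : (fun i => x (σ i)) ∘ σ.symm = x := by
      funext i; simp
    rwa [e] at this

/-- chamber of configurations ordered by `σ` -/
def Cham {N : ℕ} (σ : Equiv.Perm (Fin N)) : Set (Fin N → ℝ) := {x | StrictMono (fun i => x (σ i))}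

lemma Cham_meas {N : ℕ} (σ : Equiv.Perm (Fin N)) : MeasurableSet (Cham σ) := by
  have : Cham σ = ⋂ i : Fin N, ⋂ j : Fin N, {x : Fin N → ℝ | i < j → x (σ i) < x (σ j)} := by
    ext x
    simp only [Cham, Set.mem_iInter, Set.mem_ofPred_eq, StrictMono]
  rw [this]
  refine MeasurableSet.iInter fun i => MeasurableSet.iInter fun j => ?_
  by_cases hij : i < j
  · simp only [hij, true_imp_iff]
    exact measurableSet_lt (measurable_pi_apply _) (measurable_pi_apply _)
  · simp [hij]

lemma Cham_inj {N : ℕ} (σ : Equiv.Perm (Fin N)) (x : Fin N → ℝ) (hx : x ∈ Cham σ) :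
    Function.Injective x := by
  have hx' : StrictMono (fun i => x (σ i)) := hx
  have := hx'.injective.comp σ.symm.injective
  have e : (fun i => x (σ i)) ∘ σ.symm = x := by
    funext i; simp
  rwa [e] at this

lemma Cham_exists {N : ℕ} (x : Fin N → ℝ) (hx : Function.Injective x) : ∃ σ, x ∈ Cham σ :=
  ⟨Tuple.sort x, (Tuple.monotone_sort x).strictMono_of_injective (hx.comp (Equiv.injective _))⟩

lemma Cham_unique {N : ℕ} (x : Fin N → ℝ) (σ τ : Equiv.Perm (Fin N)) (h1 : x ∈ Cham σ)
    (h2 : x ∈ Cham τ) : σ = τ := by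
  have hinj := Cham_inj σ x h1
  have h1' : StrictMono (fun i => x (σ i)) := h1
  have h2' : StrictMono (fun i => x (τ i)) := h2
  have : (fun i => x (σ i)) = (fun i => x (τ i)) := by
    apply (StrictMono.range_inj h1' h2').1
    have e1 : Set.range (fun i => x (σ i)) = Set.range x := σ.surjective.range_comp x
    have e2 : Set.range (fun i => x (τ i)) = Set.range x := τ.surjective.range_comp x
    rw [e1, e2]
  ext i
  exact congrArg Fin.val (hinj (congrFun this i))

/-- bad set : far from every permutation of `xs` -/
def Bad {N : ℕ} (A : ℝ) (xs : Fin N → ℝ) : Set (Fin N → ℝ) :=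
  {x | ∀ σ : Equiv.Perm (Fin N), A < ∑ i, (xs (σ i) - x i) ^ 2}

lemma Bad_meas {N : ℕ} (A : ℝ) (xs : Fin N → ℝ) : MeasurableSet (Bad A xs) := by
  have : Bad A xs = ⋂ σ : Equiv.Perm (Fin N), {x | A < ∑ i, (xs (σ i) - x i) ^ 2} := by
    ext x; simp [Bad]
  rw [this]
  refine MeasurableSet.iInter fun σ => ?_
  exact measurableSet_lt measurable_const (by fun_prop)

lemma conc_pt {β : ℝ} {Q h : ℝ → ℝ} {α K H : ℝ} (P : Hyp β Q h α K H) {N : ℕ}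
    (xs : Fin N → ℝ) (hxs : IsMinC β Q h xs) (σ : Equiv.Perm (Fin N)) (x : Fin N → ℝ)
    (hx : x ∈ Cham σ) (hb : x ∈ Bad (8 / (α - K)) xs) :
    ((1 / 2 : ℝ) • (x + fun i => xs (σ.symm i))) ∈ Cham σ ∧
    weightH β Q h N x ≤ Real.exp (-2) ^ N *
      weightH β Q h N ((1 / 2 : ℝ) • (x + fun i => xs (σ.symm i))) := by
  have hc : 0 < α - K := by linarith [P.hαK]
  set y : Fin N → ℝ := fun i => xs (σ.symm i) with hy
  have hx' : StrictMono (fun i => x (σ i)) := hx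
  have e : ((1 / 2 : ℝ) • (x + y)) = fun i => (y i + x i) / 2 := by
    funext i
    simp only [Pi.smul_apply, Pi.add_apply, smul_eq_mul]; ring
  have hmem : (fun i => (y i + x i) / 2) ∈ Cham σ := by
    intro i j hij
    have h1 := hx' hij
    have h2 := hxs.1 hij
    simp only [hy, Equiv.symm_apply_apply] at *
    linarith
  rw [e]
  refine ⟨hmem, ?_⟩
  rw [weight_inj P x (Cham_inj σ x hx), weight_inj P _ (Cham_inj σ _ hmem), ← Real.exp_nat_mul,
    ← Real.exp_add]
  apply Real.exp_le_exp.2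
  have hord : ∀ i j, i ≠ j → 0 < (y i - y j) * (x i - x j) := by
    intro i j hij
    have hne : σ.symm i ≠ σ.symm j := fun hc => hij (σ.symm.injective hc)
    rcases lt_or_gt_of_ne hne with hlt | hlt
    · have h1 := hx' hlt
      have h2 := hxs.1 hlt
      simp only [Equiv.apply_symm_apply] at h1
      exact mul_pos_of_neg_of_neg (sub_neg.2 h2) (sub_neg.2 h1)
    · have h1 := hx' hlt
      have h2 := hxs.1 hlt
      simp only [Equiv.apply_symm_apply] at h1
      exact mul_pos (sub_pos.2 h2) (sub_pos.2 h1)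
  have hmin : ∀ z : Fin N → ℝ, Function.Injective z → En β Q h y ≤ En β Q h z := by
    intro z hz
    rw [hy, En_comp β Q h σ.symm xs]
    exact hxs.2 z hz
  have h1 := (En_strong P y x hord hmin).2
  rw [Fintype.card_fin] at h1
  have h2 := hb σ.symm
  have h3 : (N : ℝ) * (α - K) / 4 * (8 / (α - K)) ≤ (N : ℝ) * (α - K) / 4 * ∑ i, (y i - x i) ^ 2 :=
    mul_le_mul_of_nonneg_left h2.le (by positivity)
  have h4 : (N : ℝ) * (α - K) / 4 * (8 / (α - K)) = N * 2 := by
    field_simp; ring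
  linarith

lemma conc {β : ℝ} {Q h : ℝ → ℝ} {α K H : ℝ} (P : Hyp β Q h α K H) {N : ℕ} (hN : 0 < N)
    (xs : Fin N → ℝ) (hxs : IsMinC β Q h xs) :
    ∫ x, (Bad (8 / (α - K)) xs).indicator (weightH β Q h N) x ≤
      (2 * Real.exp (-2)) ^ N * ZH β Q h N := by
  classical
  set B := Bad (8 / (α - K)) xs with hB
  set w := weightH β Q h N with hw
  have hwi : Integrable w := weight_integrable P N hN
  have hw0 : ∀ x, 0 ≤ w x := fun x => weight_nonneg β Q h x
  have hσ : ∀ σ : Equiv.Perm (Fin N), ∫ x, (B ∩ Cham σ).indicator w x ≤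
      (2 * Real.exp (-2)) ^ N * ∫ x, (Cham σ).indicator w x := by
    intro σ
    set f := (Cham σ).indicator w with hf
    have hfi : Integrable f := hwi.indicator (Cham_meas σ)
    set y : Fin N → ℝ := fun i => xs (σ.symm i) with hy
    have hfi2 : Integrable (fun x => f ((1 / 2 : ℝ) • (x + y))) :=
      (hfi.comp_smul (by norm_num : (1 / 2 : ℝ) ≠ 0)).comp_add_right y
    have e1 : ∫ x, f ((1 / 2 : ℝ) • (x + y)) = 2 ^ N * ∫ x, f x := by
      rw [integral_add_right_eq_self (fun x => f ((1 / 2 : ℝ) • x)) y, Measure.integral_comp_smul]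
      simp
    calc ∫ x, (B ∩ Cham σ).indicator w x ≤ ∫ x, Real.exp (-2) ^ N * f ((1 / 2 : ℝ) • (x + y)) := by
          refine integral_mono (hwi.indicator ((Bad_meas _ _).inter (Cham_meas σ)))
            (hfi2.const_mul _) fun x => ?_
          by_cases hx : x ∈ B ∩ Cham σ
          · have := conc_pt P xs hxs σ x hx.2 hx.1
            simp only
            rw [Set.indicator_of_mem hx, hf, Set.indicator_of_mem this.1]
            exact this.2
          · simp only
            rw [Set.indicator_of_notMem hx]
            exact mul_nonneg (by positivity) (Set.indicator_nonneg (fun x _ => hw0 x) _)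
      _ = (2 * Real.exp (-2)) ^ N * ∫ x, f x := by
          rw [integral_const_mul, e1, mul_pow]; ring
  calc ∫ x, B.indicator w x ≤ ∫ x, ∑ σ : Equiv.Perm (Fin N), (B ∩ Cham σ).indicator w x := by
        refine integral_mono (hwi.indicator (Bad_meas _ _)) (integrable_finsetSum _ fun σ _ =>
          hwi.indicator ((Bad_meas _ _).inter (Cham_meas σ))) fun x => ?_
        have hnn : ∀ σ : Equiv.Perm (Fin N), 0 ≤ (B ∩ Cham σ).indicator w x :=
          fun σ => Set.indicator_nonneg (fun x _ => hw0 x) _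
        by_cases hx : Function.Injective x
        · obtain ⟨σ, hσ⟩ := Cham_exists x hx
          refine le_trans ?_ (Finset.single_le_sum (fun σ _ => hnn σ) (Finset.mem_univ σ))
          by_cases hxB : x ∈ B
          · rw [Set.indicator_of_mem hxB, Set.indicator_of_mem (show x ∈ B ∩ Cham σ from ⟨hxB, hσ⟩)]
          · rw [Set.indicator_of_notMem hxB]; exact hnn σ
        · have : B.indicator w x = 0 := by
            rw [Set.indicator_apply, hw, weight_noninj P.hβ Q h x hx, ite_self]
          rw [this]
          exact Finset.sum_nonneg fun σ _ => hnn σ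
    _ = ∑ σ : Equiv.Perm (Fin N), ∫ x, (B ∩ Cham σ).indicator w x :=
        integral_finsetSum _ fun σ _ => hwi.indicator ((Bad_meas _ _).inter (Cham_meas σ))
    _ ≤ ∑ σ : Equiv.Perm (Fin N), (2 * Real.exp (-2)) ^ N * ∫ x, (Cham σ).indicator w x :=
        Finset.sum_le_sum fun σ _ => hσ σ
    _ = (2 * Real.exp (-2)) ^ N * ∫ x, ∑ σ : Equiv.Perm (Fin N), (Cham σ).indicator w x := by
        rw [← Finset.mul_sum, integral_finsetSum _ fun σ _ => hwi.indicator (Cham_meas σ)]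
    _ ≤ (2 * Real.exp (-2)) ^ N * ZH β Q h N := by
        refine mul_le_mul_of_nonneg_left ?_ (by positivity)
        unfold ZH
        refine integral_mono (integrable_finsetSum _ fun σ _ => hwi.indicator (Cham_meas σ)) hwi
          fun x => ?_
        simp only
        by_cases hx : ∃ σ, x ∈ Cham σ
        · obtain ⟨σ, hσ⟩ := hx
          rw [Finset.sum_eq_single σ]
          · rw [Set.indicator_of_mem hσ]
          · intro τ _ hτ
            exact Set.indicator_of_notMem (fun hc => hτ (Cham_unique x τ σ hc hσ)) _
          · intro hc; exact absurd (Finset.mem_univ σ) hc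
        · push Not at hx
          rw [Finset.sum_eq_zero fun σ _ => Set.indicator_of_notMem (hx σ) _]
          exact hw0 x

lemma PH_nonneg (β : ℝ) (Q h : ℝ → ℝ) (N : ℕ) (x : Fin N → ℝ) : 0 ≤ PH β Q h N x := by
  unfold PH ZH
  exact div_nonneg (weight_nonneg β Q h x) (integral_nonneg fun x => weight_nonneg β Q h x)

lemma PH_integrable {β : ℝ} {Q h : ℝ → ℝ} {α K H : ℝ} (P : Hyp β Q h α K H) {N : ℕ} (hN : 0 < N) :
    Integrable (PH β Q h N) := by
  unfold PH
  exact (weight_integrable P N hN).div_const _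

lemma PH_integral {β : ℝ} {Q h : ℝ → ℝ} {α K H : ℝ} (P : Hyp β Q h α K H) {N : ℕ} (hN : 0 < N) :
    ∫ x, PH β Q h N x = 1 := by
  unfold PH
  rw [integral_div]
  exact div_self (ZH_pos P N hN).ne'

lemma PH_cont {β : ℝ} {Q h : ℝ → ℝ} {α K H : ℝ} (P : Hyp β Q h α K H) (N : ℕ) :
    Continuous (PH β Q h N) := by
  unfold PH
  exact (weight_continuous P N).div_const _

lemma PH_perm {β : ℝ} {Q h : ℝ → ℝ} {α K H : ℝ} (P : Hyp β Q h α K H) {N : ℕ}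
    (σ : Equiv.Perm (Fin N)) (x : Fin N → ℝ) :
    PH β Q h N (fun i => x (σ i)) = PH β Q h N x := by
  unfold PH
  rw [weight_perm P]

lemma PH_bdd_int {β : ℝ} {Q h : ℝ → ℝ} {α K H : ℝ} (P : Hyp β Q h α K H) {N : ℕ} (hN : 0 < N)
    (G : (Fin N → ℝ) → ℝ) (hG : Continuous G) (B : ℝ) (hB : ∀ x, |G x| ≤ B) :
    Integrable (fun x => G x * PH β Q h N x) :=
  (PH_integrable P hN).bdd_mul hG.aestronglyMeasurable (Eventually.of_forall hB)

lemma sym_int {β : ℝ} {Q h : ℝ → ℝ} {α K H : ℝ} (P : Hyp β Q h α K H) {N k : ℕ}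
    (F : (Fin k → ℝ) → ℝ) (ι τ : Fin k → Fin N) (hι : Function.Injective ι)
    (hτ : Function.Injective τ) :
    ∫ x : Fin N → ℝ, F (fun i => x (τ i)) * PH β Q h N x =
      ∫ x : Fin N → ℝ, F (fun i => x (ι i)) * PH β Q h N x := by
  obtain ⟨σ, hσ⟩ := Equiv.Perm.exists_extending_pair ι τ hι hτ
  have hmp := volume_measurePreserving_piCongrLeft (fun _ : Fin N => ℝ) σ
  rw [← hmp.integral_comp' (fun x : Fin N → ℝ => F (fun i => x (τ i)) * PH β Q h N x)]
  refine integral_congr_ae (Eventually.of_forall fun x => ?_)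
  have e : ∀ i, (MeasurableEquiv.piCongrLeft (fun _ : Fin N => ℝ) σ x) (σ i) = x i := fun i =>
    Equiv.piCongrLeft_apply_apply (fun _ : Fin N => ℝ) σ x i
  simp only
  rw [← PH_perm P σ (MeasurableEquiv.piCongrLeft (fun _ : Fin N => ℝ) σ x)]
  simp only [e, ← hσ]

lemma avg_perm {N k : ℕ} (F : (Fin k → ℝ) → ℝ) (σ : Equiv.Perm (Fin N)) (xs : Fin N → ℝ) :
    ∑ τ : Fin k → Fin N, F (fun i => xs (σ (τ i))) = ∑ τ : Fin k → Fin N, F (fun i => xs (τ i)) :=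
  Equiv.sum_comp (Equiv.arrowCongr (Equiv.refl (Fin k)) σ) (fun τ : Fin k → Fin N => F (fun i => xs (τ i)))

lemma avg_close {N k : ℕ} (hN : 0 < N) (F : (Fin k → ℝ) → ℝ) (Lp : ℝ) (hLp : 0 ≤ Lp)
    (hF : ∀ s t, |F s - F t| ≤ Lp * ∑ i, |s i - t i|) (x y : Fin N → ℝ) (A : ℝ)
    (hA : ∑ i, (y i - x i) ^ 2 ≤ A) :
    |((N : ℝ) ^ k)⁻¹ * ∑ τ : Fin k → Fin N, F (fun i => x (τ i)) -
      ((N : ℝ) ^ k)⁻¹ * ∑ τ : Fin k → Fin N, F (fun i => y (τ i))| ≤ Lp * k * Real.sqrt (A / N) := by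
  have : NeZero N := ⟨hN.ne'⟩
  have hN' : (0 : ℝ) < N := by exact_mod_cast hN
  have hNk : (0 : ℝ) < (N : ℝ) ^ k := by positivity
  rw [← mul_sub, ← Finset.sum_sub_distrib, abs_mul, abs_of_pos (by positivity), inv_mul_le_iff₀ hNk]
  have h1 : |∑ τ : Fin k → Fin N, (F (fun i => x (τ i)) - F (fun i => y (τ i)))| ≤
      Lp * ∑ i, ∑ τ : Fin k → Fin N, |x (τ i) - y (τ i)| := by
    refine (Finset.abs_sum_le_sum_abs _ _).trans ?_
    refine (Finset.sum_le_sum fun τ _ => hF _ _).trans ?_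
    rw [← Finset.mul_sum, Finset.sum_comm]
  set S := ∑ b, |x b - y b| with hS
  have h2 : ∀ i : Fin k, ∑ τ : Fin k → Fin N, |x (τ i) - y (τ i)| = (N : ℝ) ^ k * (S / N) := by
    intro i
    have := count_one N i (fun b => |x b - y b|)
    rw [Fintype.card_fin] at this
    field_simp
    linarith
  have h3 : S / N ≤ Real.sqrt (A / N) := by
    apply Real.le_sqrt_of_sq_le
    have cs := sq_sum_le_card_mul_sum_sq (s := (univ : Finset (Fin N))) (f := fun b => |x b - y b|)
    simp only [sq_abs, Finset.card_univ, Fintype.card_fin] at cs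
    have e : ∑ i, (x i - y i) ^ 2 = ∑ i, (y i - x i) ^ 2 :=
      Finset.sum_congr rfl fun i _ => by ring
    rw [e, ← hS] at cs
    rw [div_pow, div_le_div_iff₀ (by positivity) hN']
    have := mul_le_mul_of_nonneg_left hA hN'.le
    nlinarith
  refine h1.trans ?_
  simp only [h2, Finset.sum_const, Finset.card_univ, Fintype.card_fin, nsmul_eq_mul]
  have : Lp * (k * ((N : ℝ) ^ k * (S / N))) = (N : ℝ) ^ k * (Lp * k * (S / N)) := by ring
  rw [this]
  gcongr

lemma main_bound {β : ℝ} {Q h : ℝ → ℝ} {α K H : ℝ} (P : Hyp β Q h α K H) {N k : ℕ} (hN : 0 < N)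
    (ι : Fin k → Fin N) (hι : Function.Injective ι)
    (xs : Fin N → ℝ) (hxs : IsMinC β Q h xs)
    (F : (Fin k → ℝ) → ℝ) (hFc : Continuous F) (B : ℝ) (hB : ∀ s, |F s| ≤ B)
    (Lp : ℝ) (hLp : 0 ≤ Lp) (hF : ∀ s t, |F s - F t| ≤ Lp * ∑ i, |s i - t i|) :
    |(∫ x : Fin N → ℝ, F (fun i => x (ι i)) * PH β Q h N x) -
      ((N : ℝ) ^ k)⁻¹ * ∑ τ : Fin k → Fin N, F (fun i => xs (τ i))| ≤
    2 * B * (1 - (N.descFactorial k : ℝ) / (N : ℝ) ^ k) +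
      (Lp * k * Real.sqrt (8 / (α - K) / N) + 2 * B * (2 * Real.exp (-2)) ^ N) := by
  classical
  have hN' : (0 : ℝ) < N := by exact_mod_cast hN
  have hNk : (0 : ℝ) < (N : ℝ) ^ k := by positivity
  have hB0 : 0 ≤ B := (abs_nonneg _).trans (hB 0)
  have hPi := PH_integrable P hN
  have hP1 := PH_integral P hN
  have hJi : ∀ τ : Fin k → Fin N, Integrable (fun x : Fin N → ℝ => F (fun i => x (τ i)) * PH β Q h N x) :=
    fun τ => PH_bdd_int P hN _ (hFc.comp (by fun_prop)) B fun x => hB _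
  have hJb : ∀ τ : Fin k → Fin N, |∫ x : Fin N → ℝ, F (fun i => x (τ i)) * PH β Q h N x| ≤ B := by
    intro τ
    refine (abs_integral_le_integral_abs).trans ?_
    have : ∫ x : Fin N → ℝ, |F (fun i => x (τ i)) * PH β Q h N x| ≤ ∫ x, B * PH β Q h N x := by
      refine integral_mono (hJi τ).abs (hPi.const_mul B) fun x => ?_
      simp only
      rw [abs_mul, abs_of_nonneg (PH_nonneg β Q h N x)]
      exact mul_le_mul_of_nonneg_right (hB _) (PH_nonneg β Q h N x)
    rwa [integral_const_mul, hP1, mul_one] at this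
  set J : (Fin k → Fin N) → ℝ := fun τ => ∫ x : Fin N → ℝ, F (fun i => x (τ i)) * PH β Q h N x with hJ
  set av : (Fin N → ℝ) → ℝ := fun x => ((N : ℝ) ^ k)⁻¹ * ∑ τ : Fin k → Fin N, F (fun i => x (τ i)) with hav
  have hcardT : (Finset.univ : Finset (Fin k → Fin N)).card = N ^ k := by simp
  -- step 1
  have s1 : |J ι - ((N : ℝ) ^ k)⁻¹ * ∑ τ, J τ| ≤ 2 * B * (1 - (N.descFactorial k : ℝ) / (N : ℝ) ^ k) := by
    have e1 : J ι = ((N : ℝ) ^ k)⁻¹ * ∑ τ : Fin k → Fin N, J ι := by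
      rw [Finset.sum_const, hcardT, nsmul_eq_mul]
      push_cast
      field_simp
    rw [e1, ← mul_sub, ← Finset.sum_sub_distrib, abs_mul, abs_of_pos (by positivity),
      inv_mul_le_iff₀ hNk]
    refine (Finset.abs_sum_le_sum_abs _ _).trans ?_
    have hcardI : (univ.filter fun τ : Fin k → Fin N => Function.Injective τ).card = N.descFactorial k := by
      rw [← Fintype.card_subtype, Fintype.card_congr (Equiv.subtypeInjectiveEquivEmbedding (Fin k) (Fin N)),
        Fintype.card_embedding_eq, Fintype.card_fin, Fintype.card_fin]
    have h2 : ∀ τ : Fin k → Fin N, |J ι - J τ| ≤ 2 * B - (if Function.Injective τ then 2 * B else 0) := by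
      intro τ
      by_cases hτ : Function.Injective τ
      · rw [if_pos hτ, sub_self]
        have : J τ = J ι := sym_int P F ι τ hι hτ
        rw [this, sub_self, abs_zero]
      · rw [if_neg hτ, sub_zero]
        refine (abs_sub _ _).trans ?_
        linarith [hJb ι, hJb τ]
    refine (Finset.sum_le_sum fun τ _ => h2 τ).trans ?_
    rw [Finset.sum_sub_distrib, ← Finset.sum_filter, Finset.sum_const, Finset.sum_const, hcardI, hcardT,
      nsmul_eq_mul, nsmul_eq_mul]
    push_cast
    apply le_of_eq
    field_simp
  have e2 : ((N : ℝ) ^ k)⁻¹ * ∑ τ, J τ = ∫ x, av x * PH β Q h N x := by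
    rw [hJ, ← integral_finsetSum _ (fun τ _ => hJi τ), ← integral_const_mul]
    refine integral_congr_ae (Eventually.of_forall fun x => ?_)
    simp only [hav]
    rw [mul_assoc, Finset.sum_mul]
  have havb : ∀ x, |av x| ≤ B := by
    intro x
    rw [hav]
    simp only
    rw [abs_mul, abs_of_pos (by positivity), inv_mul_le_iff₀ hNk]
    refine (Finset.abs_sum_le_sum_abs _ _).trans ?_
    refine (Finset.sum_le_sum fun τ _ => hB _).trans ?_
    rw [Finset.sum_const, hcardT, nsmul_eq_mul]
    push_cast; exact le_rfl
  have havc : Continuous av := by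
    refine continuous_const.mul (continuous_finsetSum _ fun τ _ => hFc.comp (by fun_prop))
  have havi : Integrable (fun x => av x * PH β Q h N x) := PH_bdd_int P hN av havc B havb
  set ε := Lp * k * Real.sqrt (8 / (α - K) / N) with hε
  have hε0 : 0 ≤ ε := by positivity
  set Bd := Bad (8 / (α - K)) xs with hBd
  have hpt : ∀ x, |av x - av xs| ≤ ε + 2 * B * Bd.indicator 1 x := by
    intro x
    by_cases hx : x ∈ Bd
    · rw [Set.indicator_of_mem hx]
      simp only [Pi.one_apply, mul_one]
      have := abs_sub (av x) (av xs)
      linarith [havb x, havb xs]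
    · rw [Set.indicator_of_notMem hx, mul_zero, add_zero]
      simp only [hBd, Bad, Set.mem_ofPred_eq, not_forall, not_lt] at hx
      obtain ⟨σ, hσ⟩ := hx
      have := avg_close hN F Lp hLp hF x (fun i => xs (σ i)) _ hσ
      rw [avg_perm F σ xs] at this
      exact this
  have hindi : Integrable (fun x => Bd.indicator (1 : (Fin N → ℝ) → ℝ) x * PH β Q h N x) := by
    have := hPi.indicator (Bad_meas (8 / (α - K)) xs)
    refine this.congr (Eventually.of_forall fun x => ?_)
    simp only
    by_cases hx : x ∈ Bd
    · rw [Set.indicator_of_mem hx, Set.indicator_of_mem hx]; simp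
    · rw [Set.indicator_of_notMem hx, Set.indicator_of_notMem hx]; simp
  have s3 : ∫ x, Bd.indicator (1 : (Fin N → ℝ) → ℝ) x * PH β Q h N x ≤ (2 * Real.exp (-2)) ^ N := by
    have hc := conc P hN xs hxs
    have hZ := ZH_pos P N hN
    have e : ∫ x, Bd.indicator (1 : (Fin N → ℝ) → ℝ) x * PH β Q h N x =
        (∫ x, Bd.indicator (weightH β Q h N) x) / ZH β Q h N := by
      rw [← integral_div]
      refine integral_congr_ae (Eventually.of_forall fun x => ?_)
      simp only
      by_cases hx : x ∈ Bd
      · rw [Set.indicator_of_mem hx, Set.indicator_of_mem hx]; simp [PH]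
      · rw [Set.indicator_of_notMem hx, Set.indicator_of_notMem hx]; simp
    rw [e, div_le_iff₀ hZ]
    exact hc
  have s2 : |(∫ x, av x * PH β Q h N x) - av xs| ≤ ε + 2 * B * (2 * Real.exp (-2)) ^ N := by
    have e3 : (∫ x, av x * PH β Q h N x) - av xs = ∫ x, (av x - av xs) * PH β Q h N x := by
      have : ∫ x, (av x - av xs) * PH β Q h N x = ∫ x, (av x * PH β Q h N x - av xs * PH β Q h N x) :=
        integral_congr_ae (Eventually.of_forall fun x => by simp only; ring)
      rw [this, integral_sub havi (hPi.const_mul _), integral_const_mul, hP1, mul_one]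
    rw [e3]
    refine (abs_integral_le_integral_abs).trans ?_
    have h4 : ∫ x, |(av x - av xs) * PH β Q h N x| ≤
        ∫ x, (ε * PH β Q h N x + 2 * B * (Bd.indicator (1 : (Fin N → ℝ) → ℝ) x * PH β Q h N x)) := by
      refine integral_mono_of_nonneg (Eventually.of_forall fun x => abs_nonneg _)
        ((hPi.const_mul ε).add (hindi.const_mul _)) (Eventually.of_forall fun x => ?_)
      simp only
      rw [abs_mul, abs_of_nonneg (PH_nonneg β Q h N x)]
      have := mul_le_mul_of_nonneg_right (hpt x) (PH_nonneg β Q h N x)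
      linarith
    refine h4.trans ?_
    rw [integral_add (hPi.const_mul ε) (hindi.const_mul _), integral_const_mul, integral_const_mul,
      hP1, mul_one]
    have := mul_le_mul_of_nonneg_left s3 (by positivity : 0 ≤ 2 * B)
    linarith
  rw [e2] at s1
  have := abs_sub_le (J ι) (∫ x, av x * PH β Q h N x) (av xs)
  linarith

lemma err_tendsto (k : ℕ) (B Lp A : ℝ) : Tendsto (fun N : ℕ =>
    2 * B * (1 - (N.descFactorial k : ℝ) / (N : ℝ) ^ k) +
      (Lp * k * Real.sqrt (A / N) + 2 * B * (2 * Real.exp (-2)) ^ N)) atTop (𝓝 0) := by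
  have t1 : Tendsto (fun N : ℕ => (N.descFactorial k : ℝ) / (N : ℝ) ^ k) atTop (𝓝 1) := by
    have := isEquivalent_descFactorial k
    rw [Asymptotics.isEquivalent_iff_tendsto_one] at this
    · exact this
    · filter_upwards [eventually_gt_atTop 0] with n hn
      have : (0 : ℝ) < n := by exact_mod_cast hn
      positivity
  have t2 : Tendsto (fun N : ℕ => Real.sqrt (A / N)) atTop (𝓝 0) := by
    have := (tendsto_const_div_atTop_nhds_zero_nat A).sqrt
    simpa using this
  have t3 : Tendsto (fun N : ℕ => (2 * Real.exp (-2)) ^ N) atTop (𝓝 0) := by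
    apply tendsto_pow_atTop_nhds_zero_of_lt_one (by positivity)
    rw [Real.exp_neg]
    have : (2 : ℝ) < Real.exp 2 := by
      have := Real.add_one_le_exp (2 : ℝ)
      linarith
    rw [← div_eq_mul_inv, div_lt_one (by positivity)]
    exact this
  have := ((t1.const_sub 1).const_mul (2 * B)).add ((t2.const_mul (Lp * k)).add (t3.const_mul (2 * B)))
  simpa using this

lemma corr_int {β : ℝ} {Q h : ℝ → ℝ} {α K H : ℝ} (P : Hyp β Q h α K H) {N k : ℕ} (hN : 0 < N)
    (hk : k ≤ N) (F : (Fin k → ℝ) → ℝ) (hFc : Continuous F) (B : ℝ) (hB : ∀ s, |F s| ≤ B) :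
    ∫ t : Fin k → ℝ, F t * correlationFn N k (PH β Q h N) t =
      ∫ x : Fin N → ℝ, F (fun i => x (Fin.castLE hk i)) * PH β Q h N x := by
  set e : Fin k ⊕ Fin (N - k) ≃ Fin N := finSumFinEquiv.trans (finCongr (by omega)) with he
  set Φ : (Fin k → ℝ) × (Fin (N - k) → ℝ) ≃ᵐ (Fin N → ℝ) :=
    (MeasurableEquiv.sumPiEquivProdPi (fun _ : Fin k ⊕ Fin (N - k) => ℝ)).symm.trans
      (MeasurableEquiv.piCongrLeft (fun _ : Fin N => ℝ) e) with hΦ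
  have hmp : MeasurePreserving Φ volume volume :=
    (volume_measurePreserving_piCongrLeft (fun _ : Fin N => ℝ) e).comp
      (volume_measurePreserving_sumPiEquivProdPi_symm (fun _ : Fin k ⊕ Fin (N - k) => ℝ))
  have hΦe : ∀ p s, Φ p (e s) = Sum.elim p.1 p.2 s := by
    intro p s
    have := Equiv.piCongrLeft_apply_apply (fun _ : Fin N => ℝ) e
      ((MeasurableEquiv.sumPiEquivProdPi (fun _ : Fin k ⊕ Fin (N - k) => ℝ)).symm p) s
    refine Eq.trans this ?_
    cases s <;> rfl
  have hΦ1 : ∀ p i, Φ p (Fin.castLE hk i) = p.1 i := by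
    intro p i
    have := hΦe p (Sum.inl i)
    have e' : e (Sum.inl i) = Fin.castLE hk i := by
      ext
      simp [he]
    rw [e'] at this
    exact this
  have hΦ2 : ∀ p, Φ p = (fun i : Fin N => if hik : (i : ℕ) < k then p.1 ⟨(i : ℕ), hik⟩
        else p.2 ⟨(i : ℕ) - k, by have := i.isLt; omega⟩) := by
    intro p
    funext i
    by_cases hik : (i : ℕ) < k
    · rw [dif_pos hik]
      exact hΦ1 p ⟨i, hik⟩
    · rw [dif_neg hik]
      have := hΦe p (Sum.inr ⟨(i : ℕ) - k, by have := i.isLt; omega⟩)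
      have e' : e (Sum.inr ⟨(i : ℕ) - k, by have := i.isLt; omega⟩) = i := by
        ext
        simp [he]
        omega
      rw [e'] at this
      exact this
  rw [← hmp.integral_comp' (fun x : Fin N → ℝ => F (fun i => x (Fin.castLE hk i)) * PH β Q h N x)]
  have hIntg : Integrable (fun p : (Fin k → ℝ) × (Fin (N - k) → ℝ) =>
      F (fun i => Φ p (Fin.castLE hk i)) * PH β Q h N (Φ p)) := by
    have := PH_bdd_int P hN (fun x : Fin N → ℝ => F (fun i => x (Fin.castLE hk i)))
      (hFc.comp (by fun_prop)) B fun x => hB _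
    exact (hmp.integrable_comp_emb Φ.measurableEmbedding).2 this
  change _ = ∫ p, _ ∂(Measure.prod volume volume)
  rw [integral_prod _ hIntg]
  refine integral_congr_ae (Eventually.of_forall fun t => ?_)
  simp only [correlationFn]
  rw [← integral_const_mul]
  refine integral_congr_ae (Eventually.of_forall fun y => ?_)
  simp only [hΦ1]
  rw [hΦ2]

lemma margP_prob {β : ℝ} {Q h : ℝ → ℝ} {α K H : ℝ} (P : Hyp β Q h α K H) {N k : ℕ} (hN : 0 < N)
    (ι : Fin k → Fin N) :
    IsProbabilityMeasure (((volume : Measure (Fin N → ℝ)).withDensity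
      (fun x => ENNReal.ofReal (PH β Q h N x))).map (fun x i => x (ι i))) := by
  have hm : Measurable (fun (x : Fin N → ℝ) i => x (ι i)) := by fun_prop
  constructor
  rw [Measure.map_apply hm MeasurableSet.univ, Set.preimage_univ, withDensity_apply _ MeasurableSet.univ,
    Measure.restrict_univ, ← ofReal_integral_eq_lintegral_ofReal (PH_integrable P hN)
      (Eventually.of_forall fun x => PH_nonneg β Q h N x), PH_integral P hN, ENNReal.ofReal_one]

lemma margP_int {β : ℝ} {Q h : ℝ → ℝ} {α K H : ℝ} (P : Hyp β Q h α K H) {N k : ℕ}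
    (ι : Fin k → Fin N) (F : (Fin k → ℝ) → ℝ) (hF : Continuous F) :
    ∫ t, F t ∂(((volume : Measure (Fin N → ℝ)).withDensity
      (fun x => ENNReal.ofReal (PH β Q h N x))).map (fun x i => x (ι i))) =
    ∫ x : Fin N → ℝ, F (fun i => x (ι i)) * PH β Q h N x := by
  have hm : Measurable (fun (x : Fin N → ℝ) i => x (ι i)) := by fun_prop
  rw [integral_map hm.aemeasurable hF.aestronglyMeasurable,
    integral_withDensity_eq_integral_toReal_smul
      ((PH_cont P N).measurable.ennreal_ofReal) (Eventually.of_forall fun x => ENNReal.ofReal_lt_top)]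
  refine integral_congr_ae (Eventually.of_forall fun x => ?_)
  simp only [smul_eq_mul]
  rw [ENNReal.toReal_ofReal (PH_nonneg β Q h N x), mul_comm]

lemma marg_tendsto {β : ℝ} {Q h : ℝ → ℝ} {α K H : ℝ} (P : Hyp β Q h α K H)
    (x : ∀ N : ℕ, Fin (N + 1) → ℝ) (hx : ∀ N, IsMinC β Q h (x N)) (μ : ProbabilityMeasure ℝ)
    (hμ : Tendsto (fun N => empP (x N)) atTop (𝓝 μ)) (k : ℕ)
    (F : BoundedContinuousFunction (Fin (k + 1) → ℝ) ℝ) :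
    Tendsto (fun N : ℕ => ∫ t : Fin (k + 1) → ℝ, F t * correlationFn N (k + 1) (PH β Q h N) t)
      atTop (𝓝 (∫ t, F t ∂(Measure.pi fun _ : Fin (k + 1) => (μ : Measure ℝ)))) := by
  rw [← tendsto_add_atTop_iff_nat (k + 1)]
  have hle : ∀ n, k + 1 ≤ n + (k + 1) := fun n => Nat.le_add_left _ _
  set ν : ℕ → ProbabilityMeasure (Fin (k + 1) → ℝ) := fun n =>
    ⟨_, margP_prob P (N := n + (k + 1)) (by omega) (Fin.castLE (hle n))⟩ with hν
  have hνint : ∀ n (G : (Fin (k + 1) → ℝ) → ℝ), Continuous G →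
      ∫ t, G t ∂(ν n : Measure (Fin (k + 1) → ℝ)) =
      ∫ y : Fin (n + (k + 1)) → ℝ, G (fun i => y (Fin.castLE (hle n) i)) * PH β Q h (n + (k + 1)) y :=
    fun n G hG => margP_int P (Fin.castLE (hle n)) G hG
  have hconv : Tendsto ν atTop (𝓝 (ProbabilityMeasure.pi fun _ : Fin (k + 1) => μ)) := by
    rw [tendsto_iff_forall_lipschitz_integral_tendsto]
    rintro G ⟨C, hC⟩ ⟨Lp, hLp⟩
    have hB : ∀ s, |G s| ≤ C + |G 0| := by
      intro s
      have h1 := hC s 0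
      rw [Real.dist_eq] at h1
      have h2 := abs_add_le (G s - G 0) (G 0)
      rw [sub_add_cancel] at h2
      linarith
    have hL : ∀ s t, |G s - G t| ≤ Lp * ∑ i, |s i - t i| := by
      intro s t
      have h1 := hLp.dist_le_mul s t
      rw [Real.dist_eq] at h1
      refine h1.trans (mul_le_mul_of_nonneg_left ?_ Lp.coe_nonneg)
      rw [dist_pi_le_iff (Finset.sum_nonneg fun i _ => abs_nonneg _)]
      intro i
      rw [Real.dist_eq]
      exact Finset.single_le_sum (f := fun i => |s i - t i|) (fun i _ => abs_nonneg _) (Finset.mem_univ i)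
    -- empirical convergence
    have hpi : Tendsto (fun n => ProbabilityMeasure.pi fun _ : Fin (k + 1) => empP (x (n + k))) atTop
        (𝓝 (ProbabilityMeasure.pi fun _ : Fin (k + 1) => μ)) := by
      have hc : Continuous fun ρ : ProbabilityMeasure ℝ =>
          ProbabilityMeasure.pi fun _ : Fin (k + 1) => ρ := by fun_prop
      exact (hc.tendsto μ).comp (hμ.comp (tendsto_add_atTop_nat k))
    rw [tendsto_iff_forall_lipschitz_integral_tendsto] at hpi
    have h1 := hpi G ⟨C, hC⟩ ⟨Lp, hLp⟩
    have herr := (tendsto_add_atTop_iff_nat (k + 1)).2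
      (err_tendsto (k + 1) (C + |G 0|) Lp (8 / (α - K)))
    have h2 : Tendsto (fun n => (∫ t, G t ∂(ν n : Measure (Fin (k + 1) → ℝ))) -
        ∫ t, G t ∂((ProbabilityMeasure.pi fun _ : Fin (k + 1) => empP (x (n + k)) :
          ProbabilityMeasure (Fin (k + 1) → ℝ)) : Measure (Fin (k + 1) → ℝ))) atTop (𝓝 0) := by
      refine squeeze_zero_norm (fun n => ?_) herr
      rw [Real.norm_eq_abs, hνint n G hLp.continuous]
      have h3 : ∫ t, G t ∂((ProbabilityMeasure.pi fun _ : Fin (k + 1) => empP (x (n + k)) :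
          ProbabilityMeasure (Fin (k + 1) → ℝ)) : Measure (Fin (k + 1) → ℝ)) =
          (((n + (k + 1) : ℕ) : ℝ) ^ (k + 1))⁻¹ *
            ∑ τ : Fin (k + 1) → Fin (n + (k + 1)), G (fun i => x (n + k) (τ i)) :=
        emp_pi_integral (N := n + (k + 1)) (by omega) (x (n + k)) (k + 1) G
      rw [h3]
      exact main_bound P (N := n + (k + 1)) (by omega) (Fin.castLE (hle n))
        (Fin.castLE_injective (hle n)) (x (n + k)) (hx (n + k)) G hLp.continuous _ hB Lp Lp.coe_nonneg hL
    have h4 := h2.add h1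
    simpa using h4
  rw [ProbabilityMeasure.tendsto_iff_forall_integral_tendsto] at hconv
  refine (hconv F).congr fun n => ?_
  rw [hνint n F F.continuous]
  exact (corr_int P (N := n + (k + 1)) (by omega) (hle n) F F.continuous ‖F‖
    (fun s => F.norm_coe_le_norm s)).symm

lemma main_thm {β : ℝ} {Q h : ℝ → ℝ} {α K H : ℝ} (P : Hyp β Q h α K H) :
    ∃ g : ℝ → ℝ,
      (∀ t, 0 ≤ g t) ∧ Measurable g ∧ (∫ t : ℝ, g t) = 1 ∧
      (∀ f : BoundedContinuousFunction ℝ ℝ,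
        Tendsto
          (fun N : ℕ => ∫ t : ℝ, f t * correlationFn N 1 (PH β Q h N) (fun _ => t))
          atTop (𝓝 (∫ t : ℝ, f t * g t))) ∧
      (∀ k : ℕ, 0 < k →
        ∀ F : BoundedContinuousFunction (Fin k → ℝ) ℝ,
          Tendsto
            (fun N : ℕ =>
              ∫ t : Fin k → ℝ, F t * correlationFn N k (PH β Q h N) t)
            atTop (𝓝 (∫ t : Fin k → ℝ, F t * ∏ i, g (t i)))) := by
  choose x hx using fun N : ℕ => exists_min P (N + 1) N.succ_pos
  have hx' : ∀ N, IsMinC β Q h (x N) := hx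
  obtain ⟨μ, hac, hμ⟩ := limit_measure P x hx'
  set g : ℝ → ℝ := fun t => ((μ : Measure ℝ).rnDeriv volume t).toReal with hg
  have hg0 : ∀ t, 0 ≤ g t := fun t => ENNReal.toReal_nonneg
  have hgm : Measurable g := (Measure.measurable_rnDeriv _ _).ennreal_toReal
  have hgi : Integrable g := Measure.integrable_toReal_rnDeriv
  have hg1 : ∫ t, g t = 1 := by
    rw [hg, Measure.integral_toReal_rnDeriv hac]
    simp
  have hμg : (μ : Measure ℝ) = volume.withDensity (fun t => ENNReal.ofReal (g t)) := by
    have h1 := Measure.withDensity_rnDeriv_eq _ _ hac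
    rw [← h1]
    refine withDensity_congr_ae ?_
    filter_upwards [Measure.rnDeriv_lt_top (μ : Measure ℝ) volume] with t ht
    rw [hg, ENNReal.ofReal_toReal ht.ne]
  have hk : ∀ k : ℕ, 0 < k →
        ∀ F : BoundedContinuousFunction (Fin k → ℝ) ℝ,
          Tendsto
            (fun N : ℕ =>
              ∫ t : Fin k → ℝ, F t * correlationFn N k (PH β Q h N) t)
            atTop (𝓝 (∫ t : Fin k → ℝ, F t * ∏ i, g (t i))) := by
    intro k hk F
    obtain ⟨k, rfl⟩ := Nat.exists_eq_succ_of_ne_zero hk.ne'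
    have h1 := marg_tendsto P x hx' μ hμ k F
    have hmeas : Measurable (fun t : Fin (k + 1) → ℝ => ENNReal.ofReal (∏ i, g (t i))) :=
      (Finset.measurable_fun_prod _ fun i _ =>
        hgm.comp (measurable_pi_apply i)).ennreal_ofReal
    rw [pi_density (μ : Measure ℝ) g hg0 hgi hμg (k + 1),
      integral_withDensity_eq_integral_toReal_smul hmeas
        (Eventually.of_forall fun x => ENNReal.ofReal_lt_top)] at h1
    convert! h1 using 2
    refine integral_congr_ae (Eventually.of_forall fun t => ?_)
    simp only [smul_eq_mul]
    rw [ENNReal.toReal_ofReal (Finset.prod_nonneg fun i _ => hg0 _), mul_comm]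
  refine ⟨g, hg0, hgm, hg1, ?_, hk⟩
  intro f
  have h1 := hk 1 one_pos (f.compContinuous ⟨fun t : Fin 1 → ℝ => t 0, by fun_prop⟩)
  have hmp := volume_preserving_funUnique (Fin 1) ℝ
  have e : ∀ t : Fin 1 → ℝ, (MeasurableEquiv.funUnique (Fin 1) ℝ) t = t 0 := fun t => rfl
  have e' : ∀ t : Fin 1 → ℝ, (fun _ => t 0) = t := by
    intro t; funext i; rw [Subsingleton.elim i 0]
  have h2 : ∀ N : ℕ, ∫ t : ℝ, f t * correlationFn N 1 (PH β Q h N) (fun _ => t) =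
      ∫ t : Fin 1 → ℝ, f (t 0) * correlationFn N 1 (PH β Q h N) t := by
    intro N
    rw [← hmp.integral_comp' (fun t : ℝ => f t * correlationFn N 1 (PH β Q h N) (fun _ => t))]
    simp only [e, e']
    congr!
  have h3 : ∫ t : ℝ, f t * g t = ∫ t : Fin 1 → ℝ, f (t 0) * ∏ i, g (t i) := by
    rw [← hmp.integral_comp' (fun t : ℝ => f t * g t)]
    simp only [e, Fin.prod_univ_one, Fin.isValue]
    congr!
  simp only [h2, h3]
  exact h1

/-- for every `k`, the `k`-th correlation measure of `P_{N,Q,β}^h`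
converges weakly to the `k`-fold product of the weak limit `μ_{Q,β}^h` of the first
correlation measure. -/
theorem kth_correlation_measure_converges_to_product
    (β : ℝ) (hβ : 0 < β) (h : ℝ → ℝ)
    (hAn : ∀ x : ℝ, AnalyticAt ℝ h x) (hEv : IsEvenFun h) (hSch : IsSchwartz h) :
    ∃ αh : ℝ, 0 ≤ αh ∧
      ∀ Q : ℝ → ℝ, (∀ x : ℝ, AnalyticAt ℝ Q x) → (∃ c > 0, ∀ t : ℝ, c ≤ iteratedDeriv 2 Q t) →
        IsEvenFun Q → αh < alphaQ Q →
        ∃ g : ℝ → ℝ,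
          -- `g` is the density of the probability measure `μ_{Q,β}^h`,
          -- the weak limit of the first correlation measure
          (∀ t, 0 ≤ g t) ∧ Measurable g ∧ (∫ t : ℝ, g t) = 1 ∧
          (∀ f : BoundedContinuousFunction ℝ ℝ,
            Tendsto
              (fun N : ℕ => ∫ t : ℝ, f t * correlationFn N 1 (PH β Q h N) (fun _ => t))
              atTop (𝓝 (∫ t : ℝ, f t * g t))) ∧
          -- the k-th correlation measure converges weakly to the k-fold product
          (∀ k : ℕ, 0 < k →
            ∀ F : BoundedContinuousFunction (Fin k → ℝ) ℝ,
              Tendsto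
                (fun N : ℕ =>
                  ∫ t : Fin k → ℝ, F t * correlationFn N k (PH β Q h N) t)
                atTop (𝓝 (∫ t : Fin k → ℝ, F t * ∏ i, g (t i)))) := by
  obtain ⟨K, H, hK, hK2, hH, hH1⟩ := exists_K h hAn hSch
  refine ⟨K, hK, fun Q hQ hc hQe hα => ?_⟩
  exact main_thm (mkHyp β hβ h hAn hEv K H hK hK2 hH hH1 Q hQ hc hQe hα)

end
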